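/- arXiv:1209.6391 — 7 statements merged into one kernel-verified Lean document; each statement's English description precedes it below -/
import Mathlib

section
/- For every integer k ≥ 1 there exists a constant c > 0 (depending only on k) such that for all sufficiently large real N, the integral over the cube [-N,N]^k ⊂ ℝ^k of g(t_1·t_2·⋯·t_k) with respect to Lebesgue measure is at least c·(log N)^{k-1}. -/
open MeasureTheory Real

/-- `g u = sin u / u`, extended by `g 0 = 1`. -/
noncomputable def g (u : ℝ) : ℝ := if u = 0 then 1 else Real.sin u / u

theorem g_eq_sinc : g = Real.sinc := rfl

/-- For `1 ≤ x`, compare the sine integral with `(1 - cos x) / x` using monotonicity of the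
difference. -/
theorem integral_sinc_one_sub_le {x : ℝ} (hx : 1 ≤ x) :
    (∫ t in (0 : ℝ)..1, sinc t) - (1 - cos 1) ≤
      (∫ t in (0 : ℝ)..x, sinc t) - (1 - cos x) / x := by
  have hder : ∀ y : ℝ, 0 < y → HasDerivAt
      (fun y => (∫ t in (0 : ℝ)..y, sinc t) - (1 - cos y) / y) ((1 - cos y) / y ^ 2) y := by
    intro y hy
    have h1 : HasDerivAt (fun y => ∫ t in (0 : ℝ)..y, sinc t) (sinc y) y :=
      continuous_sinc.integral_hasStrictDerivAt 0 y |>.hasDerivAt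
    have h2 := ((hasDerivAt_cos y).const_sub 1).div (hasDerivAt_id y) hy.ne'
    refine (h1.sub h2).congr_deriv ?_
    rw [sinc_of_ne_zero hy.ne']
    simp only [id]
    field_simp
    ring
  have hmono : MonotoneOn (fun y => (∫ t in (0 : ℝ)..y, sinc t) - (1 - cos y) / y)
      (Set.Ici 1) := by
    refine monotoneOn_of_hasDerivWithinAt_nonneg (convex_Ici 1)
      (fun y hy => (hder y (zero_lt_one.trans_le hy)).continuousAt.continuousWithinAt)
      (f' := fun y => (1 - cos y) / y ^ 2) ?_ ?_
    · intro y hy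
      rw [interior_Ici] at hy
      exact (hder y (zero_lt_one.trans hy)).hasDerivWithinAt
    · intro y _
      have := cos_le_one y
      exact div_nonneg (by linarith) (sq_nonneg y)
  simpa using hmono Set.self_mem_Ici hx hx

theorem quarter_le_integral_sinc {x : ℝ} (hx : 1 ≤ x) :
    1 / 4 ≤ ∫ t in (0 : ℝ)..x, sinc t := by
  have h1 : (5 / 6 : ℝ) ≤ ∫ t in (0 : ℝ)..1, sinc t := by
    have : ∫ _ in (0 : ℝ)..1, (5 / 6 : ℝ) ≤ ∫ t in (0 : ℝ)..1, sinc t := by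
      refine intervalIntegral.integral_mono_on_of_le_Ioo zero_le_one (by simp)
        (continuous_sinc.intervalIntegrable _ _) fun t ht => ?_
      have h := sin_gt_sub_cube ht.1
      rw [sinc_of_ne_zero ht.1.ne', le_div_iff₀ ht.1]
      nlinarith [mul_nonneg ht.1.le (mul_nonneg (sub_nonneg.2 ht.2.le) (by linarith [ht.1] :
        (0 : ℝ) ≤ 1 + t))]
    simpa using this
  have h2 := one_sub_sq_div_two_le_cos (x := 1)
  have h3 := integral_sinc_one_sub_le hx
  have h4 : 0 ≤ (1 - cos x) / x := div_nonneg (by linarith [cos_le_one x]) (by linarith)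
  linarith

theorem integral_sinc_nonneg {x : ℝ} (hx : 0 ≤ x) : 0 ≤ ∫ t in (0 : ℝ)..x, sinc t := by
  rcases le_total 1 x with h | h
  · linarith [quarter_le_integral_sinc h]
  · refine intervalIntegral.integral_nonneg hx fun t ht => ?_
    rw [sinc_apply]
    split_ifs
    · exact zero_le_one
    · exact div_nonneg
        (sin_nonneg_of_nonneg_of_le_pi ht.1 (by linarith [ht.2, pi_gt_three])) ht.1

theorem integral_sinc_symm (x : ℝ) :
    ∫ t in -x..x, sinc t = 2 * ∫ t in (0 : ℝ)..x, sinc t := by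
  have hi (a b : ℝ) : IntervalIntegrable sinc volume a b := continuous_sinc.intervalIntegrable a b
  rw [← intervalIntegral.integral_add_adjacent_intervals (hi (-x) 0) (hi 0 x)]
  have : ∫ t in -x..0, sinc t = ∫ t in (0 : ℝ)..x, sinc t := by
    have := intervalIntegral.integral_comp_neg (a := 0) (b := x) sinc
    simpa [sinc_neg] using this.symm
  rw [this]
  ring

theorem integral_sinc_mul {p : ℝ} (hp : 0 < p) (N : ℝ) :
    ∫ t in -N..N, sinc (t * p) = 2 * (∫ t in (0 : ℝ)..N * p, sinc t) / p := by
  rw [intervalIntegral.integral_comp_mul_right _ hp.ne', neg_mul, integral_sinc_symm, smul_eq_mul]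
  ring

theorem integral_sinc_mul_nonneg (p : ℝ) {N : ℝ} (hN : 0 ≤ N) :
    0 ≤ ∫ t in -N..N, sinc (t * p) := by
  have key : ∀ q : ℝ, 0 < q → 0 ≤ ∫ t in -N..N, sinc (t * q) := fun q hq => by
    rw [integral_sinc_mul hq]
    have := integral_sinc_nonneg (mul_nonneg hN hq.le)
    positivity
  rcases lt_trichotomy p 0 with h | rfl | h
  · have := key (-p) (by linarith)
    simpa [sinc_neg] using this
  · simp; linarith
  · exact key p h

theorem inv_le_integral_sinc_mul {p N : ℝ} (hp : 1 ≤ p) (hN : 1 ≤ N) :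
    1 / 2 * p⁻¹ ≤ ∫ t in -N..N, sinc (t * p) := by
  have hp0 : 0 < p := by linarith
  rw [integral_sinc_mul hp0, div_eq_mul_inv]
  have := quarter_le_integral_sinc (one_le_mul_of_one_le_of_one_le hN hp)
  exact mul_le_mul_of_nonneg_right (by linarith) (inv_nonneg.2 hp0.le)

theorem integral_cube_prod_inv (n : ℕ) {N : ℝ} (hN : 1 ≤ N) :
    ∫ t in Set.Icc (fun _ : Fin n => (1 : ℝ)) (fun _ => N), ∏ i, (t i)⁻¹ = log N ^ n := by
  rw [← Set.pi_univ_Icc, volume_pi, Measure.restrict_pi_pi,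
    integral_fintype_prod_eq_prod (fun _ x => x⁻¹)]
  simp only [Finset.prod_const, Finset.card_univ, Fintype.card_fin]
  rw [integral_Icc_eq_integral_Ioc, ← intervalIntegral.integral_of_le hN,
    integral_inv_of_pos one_pos (by linarith), div_one]

/-- Fubini on a cube, integrating the first coordinate innermost. -/
theorem integral_cube_succ (n : ℕ) {f : ℝ → ℝ} (hf : Continuous f) {N : ℝ} (hN : 0 ≤ N) :
    ∫ t in Set.Icc (fun _ : Fin (n + 1) => -N) (fun _ => N), f (∏ i, t i) =
      ∫ s in Set.Icc (fun _ : Fin n => -N) (fun _ => N), ∫ t in -N..N, f (t * ∏ i, s i) := by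
  have hem := (volume_preserving_piFinSuccAbove (fun _ : Fin (n + 1) => ℝ) 0).symm
  have hpre : (MeasurableEquiv.piFinSuccAbove (fun _ : Fin (n + 1) => ℝ) 0).symm ⁻¹'
      Set.Icc (fun _ => -N) (fun _ => N) =
        Set.Icc (-N) N ×ˢ Set.Icc (fun _ : Fin n => -N) (fun _ => N) :=
    ((Fin.insertNthOrderIso (fun _ => ℝ) 0).preimage_Icc _ _).trans (Set.Icc_prod_eq _ _)
  rw [← hem.setIntegral_preimage_emb (MeasurableEquiv.measurableEmbedding _), hpre,
    Measure.volume_eq_prod, ← setIntegral_prod_swap, setIntegral_prod]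
  · refine setIntegral_congr_fun measurableSet_Icc fun s _ => ?_
    rw [integral_Icc_eq_integral_Ioc, ← intervalIntegral.integral_of_le (by linarith)]
    simp [MeasurableEquiv.piFinSuccAbove, Fin.prod_univ_succ]
  · refine ContinuousOn.integrableOn_compact (isCompact_Icc.prod isCompact_Icc) ?_
    simp only [MeasurableEquiv.piFinSuccAbove, Fin.prod_univ_succ]
    simp
    fun_prop

/-- For every integer `k ≥ 1` there is `c > 0` such that for all sufficiently large `N`,
the integral of `g (t₁ ⋯ t_k)` over the cube `[-N, N]^k` is at least `c · (log N)^(k-1)`. -/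
theorem cube_integral_lower_bound (k : ℕ) (hk : 1 ≤ k) :
    ∃ c : ℝ, 0 < c ∧ ∃ N₀ : ℝ, ∀ N : ℝ, N₀ ≤ N →
      c * (Real.log N) ^ (k - 1) ≤
        ∫ t in Set.Icc (fun _ : Fin k => -N) (fun _ : Fin k => N), g (∏ i, t i) := by
  obtain ⟨n, rfl⟩ := Nat.exists_eq_add_of_le' hk
  refine ⟨1 / 2, by norm_num, 1, fun N hN => ?_⟩
  have hN0 : 0 ≤ N := by linarith
  rw [g_eq_sinc, integral_cube_succ n continuous_sinc hN0, Nat.add_sub_cancel,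
    ← integral_cube_prod_inv n hN, ← integral_const_mul]
  have hcont : Continuous fun s : Fin n → ℝ => ∫ t in -N..N, sinc (t * ∏ i, s i) :=
    intervalIntegral.continuous_parametric_intervalIntegral_of_continuous'
      (f := fun (s : Fin n → ℝ) t => sinc (t * ∏ i, s i))
      (continuous_sinc.comp (f := fun q : (Fin n → ℝ) × ℝ => q.2 * ∏ i, q.1 i) (by fun_prop)) _ _
  calc ∫ t in Set.Icc (fun _ : Fin n => (1 : ℝ)) (fun _ => N), 1 / 2 * ∏ i, (t i)⁻¹
      ≤ ∫ s in Set.Icc (fun _ : Fin n => (1 : ℝ)) (fun _ => N),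
          ∫ t in -N..N, sinc (t * ∏ i, s i) := by
        refine setIntegral_mono_on ?_ (hcont.continuousOn.integrableOn_compact isCompact_Icc)
          measurableSet_Icc fun s hs => ?_
        · refine ContinuousOn.integrableOn_compact isCompact_Icc ?_
          refine continuousOn_const.mul (continuousOn_finsetProd _ fun i _ => ?_)
          exact (continuous_apply i).continuousOn.inv₀ fun s hs =>
            (zero_lt_one.trans_le (hs.1 i)).ne'
        · rw [Finset.prod_inv_distrib]
          exact inv_le_integral_sinc_mul (Finset.one_le_prod fun i _ => hs.1 i) hN
    _ ≤ _ := by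
        refine setIntegral_mono_set (hcont.continuousOn.integrableOn_compact isCompact_Icc)
          (ae_of_all _ fun s => integral_sinc_mul_nonneg _ hN0)
          (Set.Icc_subset_Icc_left fun i => ?_).eventuallyLE
        linarith
end

section
/- For every integer k ≥ 1 there exist constants c > 0 and T₀ > 0 such that for every t ≥ T₀, the integral ∫₀ᵗ H^{k-1}F(u) du is at least c·(log t)^{k-1}, where F = g. -/
open MeasureTheory Real

/-- The averaging operator `H f (x) = (1/x) ∫₀ˣ f(u) du` for `x ≠ 0`, with `H f (0) = f 0`. -/
noncomputable def H (f : ℝ → ℝ) : ℝ → ℝ :=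
  fun x => if x = 0 then f 0 else (1 / x) * ∫ u in (0:ℝ)..x, f u

theorem H_eq_dslope (f : ℝ → ℝ) (hf : Continuous f) :
    H f = dslope (fun x => ∫ u in (0:ℝ)..x, f u) 0 := by
  funext x
  by_cases hx : x = 0
  · subst hx
    simp [H, hf.deriv_integral]
  · simp [H, hx, dslope_of_ne, slope_def_field, div_eq_inv_mul]

theorem continuous_H {f : ℝ → ℝ} (hf : Continuous f) : Continuous (H f) := by
  have hd : ∀ x, HasDerivAt (fun x => ∫ u in (0:ℝ)..x, f u) (f x) x := fun x =>
    hf.integral_hasStrictDerivAt 0 x |>.hasDerivAt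
  rw [H_eq_dslope f hf, ← continuousOn_univ, continuousOn_dslope Filter.univ_mem]
  exact ⟨fun x _ => (hd x).continuousAt.continuousWithinAt, (hd 0).differentiableAt⟩

theorem continuous_iterate_H (n : ℕ) : Continuous (H^[n] g) := by
  induction n with
  | zero => exact Real.continuous_sinc
  | succ n ih =>
    rw [Function.iterate_succ_apply']
    exact continuous_H ih

/-- A function with nonnegative derivative on `[1, ∞)` is bounded below there by its value
at `1`. -/
theorem apply_one_le_of_hasDerivAt_nonneg {f f' : ℝ → ℝ}
    (hf : ∀ x, 1 ≤ x → HasDerivAt f (f' x) x) (hf' : ∀ x, 1 ≤ x → 0 ≤ f' x)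
    {t : ℝ} (ht : 1 ≤ t) : f 1 ≤ f t := by
  refine monotoneOn_of_hasDerivWithinAt_nonneg (f' := f') (convex_Ici (1:ℝ))
    (fun x hx => (hf x hx).continuousAt.continuousWithinAt)
    (fun x hx => (hf x (interior_subset hx)).hasDerivWithinAt)
    (fun x hx => hf' x (interior_subset hx)) Set.self_mem_Ici ht ht

theorem two_div_pi_le_g {u : ℝ} (h0 : 0 ≤ u) (h1 : u ≤ 1) : 2 / π ≤ g u := by
  have hpi := Real.pi_gt_three
  rcases h0.eq_or_lt with rfl | hu
  · simp only [g, if_true]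
    rw [div_le_one (by linarith)]
    linarith
  · rw [g, if_neg hu.ne', le_div_iff₀ hu]
    exact Real.mul_le_sin h0 (by linarith)

theorem integral_g_nonneg_of_le_one {t : ℝ} (h0 : 0 ≤ t) (h1 : t ≤ 1) :
    0 ≤ ∫ u in (0:ℝ)..t, g u :=
  intervalIntegral.integral_nonneg h0 fun _ hu =>
    (by positivity : (0:ℝ) ≤ 2 / π).trans (two_div_pi_le_g hu.1 (hu.2.trans h1))

theorem two_div_pi_le_integral_g : 2 / π ≤ ∫ u in (0:ℝ)..1, g u := by
  have h := intervalIntegral.integral_mono_on (μ := volume) zero_le_one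
    (continuous_const.intervalIntegrable (μ := volume) 0 1)
    ((continuous_iterate_H 0).intervalIntegrable (μ := volume) 0 1)
    (fun u hu => two_div_pi_le_g hu.1 hu.2)
  simpa using h

/-- Integrating by parts, `∫₀ᵗ g` exceeds `(1 - cos t) / t` by a nondecreasing function of `t`. -/
theorem integral_g_lower_bound {t : ℝ} (ht : 1 ≤ t) :
    2 / π - 1 / 2 ≤ ∫ u in (0:ℝ)..t, g u := by
  have key := apply_one_le_of_hasDerivAt_nonneg
    (f := fun x => (∫ u in (0:ℝ)..x, g u) - (1 - Real.cos x) / x)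
    (f' := fun x => (1 - Real.cos x) / x ^ 2)
    (fun x hx => by
      have hx0 : x ≠ 0 := by linarith
      have h1 := ((continuous_iterate_H 0).integral_hasStrictDerivAt 0 x).hasDerivAt
      have h2 := ((Real.hasDerivAt_cos x).const_sub 1).div (hasDerivAt_id x) hx0
      refine (h1.sub h2).congr_deriv ?_
      simp only [Function.iterate_zero, id, g, if_neg hx0]
      field_simp
      ring)
    (fun x _ => div_nonneg (by linarith [Real.cos_le_one x]) (sq_nonneg x)) ht
  have hcos : 0 ≤ (1 - Real.cos t) / t :=
    div_nonneg (by linarith [Real.cos_le_one t]) (by linarith)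
  have hone := Real.one_sub_sq_div_two_le_cos (x := 1)
  have := two_div_pi_le_integral_g
  norm_num at key hone
  linarith

theorem two_div_pi_sub_half_pos : 0 < 2 / π - 1 / 2 := by
  rw [sub_pos, div_lt_div_iff₀ (by norm_num) Real.pi_pos]
  linarith [Real.pi_lt_four]

theorem hasDerivAt_integral_iterate_H_succ (n : ℕ) {x : ℝ} (hx : x ≠ 0) :
    HasDerivAt (fun t => ∫ u in (0:ℝ)..t, (H^[n + 1] g) u)
      ((∫ u in (0:ℝ)..x, (H^[n] g) u) / x) x := by
  refine ((continuous_iterate_H (n + 1)).integral_hasStrictDerivAt 0 x).hasDerivAt.congr_deriv ?_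
  rw [Function.iterate_succ_apply', H, if_neg hx]
  ring

theorem integral_iterate_H_nonneg (n : ℕ) {t : ℝ} (ht : 0 ≤ t) :
    0 ≤ ∫ u in (0:ℝ)..t, (H^[n] g) u := by
  induction n generalizing t with
  | zero =>
    rcases le_total t 1 with h | h
    · exact integral_g_nonneg_of_le_one ht h
    · exact two_div_pi_sub_half_pos.le.trans (integral_g_lower_bound h)
  | succ n ih =>
    refine intervalIntegral.integral_nonneg ht fun u hu => ?_
    rw [Function.iterate_succ_apply', H]
    split_ifs with h
    · have : ∀ m, (H^[m] g) 0 = 1 := fun m => by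
        induction m with
        | zero => simp [g]
        | succ m ihm => rw [Function.iterate_succ_apply', H, if_pos rfl, ihm]
      rw [this]
      exact zero_le_one
    · exact mul_nonneg (one_div_nonneg.2 hu.1) (ih hu.1)

theorem exists_log_pow_le_integral_iterate_H (n : ℕ) :
    ∃ c : ℝ, 0 < c ∧ ∀ t : ℝ, 1 ≤ t →
      c * Real.log t ^ n ≤ ∫ u in (0:ℝ)..t, (H^[n] g) u := by
  induction n with
  | zero =>
    exact ⟨_, two_div_pi_sub_half_pos, fun t ht => by simpa using integral_g_lower_bound ht⟩
  | succ n ih =>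
    obtain ⟨c, hc, h⟩ := ih
    refine ⟨c / (n + 1), by positivity, fun t ht => ?_⟩
    have key := apply_one_le_of_hasDerivAt_nonneg
      (f := fun x => (∫ u in (0:ℝ)..x, (H^[n + 1] g) u) - c / (n + 1) * Real.log x ^ (n + 1))
      (f' := fun x => ((∫ u in (0:ℝ)..x, (H^[n] g) u) - c * Real.log x ^ n) / x)
      (fun x hx => by
        have hx0 : x ≠ 0 := by linarith
        refine ((hasDerivAt_integral_iterate_H_succ n hx0).sub
          (((Real.hasDerivAt_log hx0).pow (n + 1)).const_mul (c / (n + 1)))).congr_deriv ?_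
        have hn : (n : ℝ) + 1 ≠ 0 := by positivity
        push_cast
        field_simp)
      (fun x hx => div_nonneg (sub_nonneg.2 (h x hx)) (by linarith)) ht
    have hone := integral_iterate_H_nonneg (n + 1) zero_le_one
    simp only [Real.log_one, zero_pow n.succ_ne_zero, mul_zero, sub_zero] at key
    linarith

/-- For every integer `k ≥ 1` there are constants `c > 0` and `T₀ > 0` such that
`∫₀ᵗ H^(k-1) F (u) du ≥ c · (log t)^(k-1)` for every `t ≥ T₀`, where `F = g`. -/
theorem iterated_average_integral_lower_bound (k : ℕ) (hk : 1 ≤ k) :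
    ∃ c : ℝ, 0 < c ∧ ∃ T₀ : ℝ, 0 < T₀ ∧ ∀ t : ℝ, T₀ ≤ t →
      c * (Real.log t) ^ (k - 1) ≤ ∫ u in (0:ℝ)..t, (H^[k - 1] g) u := by
  obtain ⟨c, hc, h⟩ := exists_log_pow_le_integral_iterate_H (k - 1)
  exact ⟨c, hc, 1, one_pos, h⟩
end

section
/- For every integer k ≥ 1 and every real N > 0, the integral over the cube [0,N]^k ⊂ ℝ^k of g(t_1·t_2·⋯·t_k) with respect to Lebesgue measure equals ∫₀^{N^k} H^{k-1}F(u) du. -/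
open MeasureTheory Real

/-- The average over `[0, x]` as an integral over the unit interval. -/
theorem H_apply_eq_integral (f : ℝ → ℝ) (x : ℝ) : H f x = ∫ s in (0:ℝ)..1, f (x * s) := by
  by_cases hx : x = 0
  · simp [H, hx]
  · simp [H, hx]

theorem mul_H_self (f : ℝ → ℝ) (x : ℝ) : x * H f x = ∫ u in (0:ℝ)..x, f u := by
  by_cases hx : x = 0
  · simp [hx]
  · simp [H, hx]

theorem integral_comp_mul_eq_mul_H (f : ℝ → ℝ) (N a : ℝ) :
    ∫ s in (0:ℝ)..N, f (a * s) = N * H f (a * N) := by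
  have h := intervalIntegral.mul_integral_comp_mul_left (a := 0) (b := 1)
    (f := fun s => f (a * s)) N
  rw [mul_zero, mul_one] at h
  rw [H_apply_eq_integral, ← h]
  simp only [mul_assoc]

theorem setIntegral_Icc_fin_succ {k : ℕ} {N : ℝ} {F : ℝ → (Fin k → ℝ) → ℝ}
    (hF : Continuous fun z : ℝ × (Fin k → ℝ) => F z.1 z.2) :
    (∫ t in Set.Icc (fun _ : Fin (k + 1) => (0:ℝ)) (fun _ => N), F (t 0) (fun i => t i.succ)) =
      ∫ t in Set.Icc (fun _ : Fin k => (0:ℝ)) (fun _ => N), ∫ s in Set.Icc 0 N, F s t := by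
  have hmp := volume_preserving_piFinSuccAbove (fun _ : Fin (k + 1) => ℝ) 0
  have hpre : Set.Icc (fun _ : Fin (k + 1) => (0:ℝ)) (fun _ => N) =
      MeasurableEquiv.piFinSuccAbove (fun _ : Fin (k + 1) => ℝ) 0 ⁻¹'
        (Set.Icc 0 N ×ˢ Set.Icc (fun _ : Fin k => (0:ℝ)) (fun _ => N)) := by
    ext t
    simp only [Set.mem_Icc, Pi.le_def, Fin.forall_fin_succ, Set.mem_preimage, Set.mem_prod,
      MeasurableEquiv.piFinSuccAbove_apply, Fin.insertNthEquiv_symm_apply, Fin.removeNth_apply,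
      Fin.succAbove_zero]
    tauto
  have hint : IntegrableOn (fun z : ℝ × (Fin k → ℝ) => F z.1 z.2)
      (Set.Icc 0 N ×ˢ Set.Icc (fun _ : Fin k => (0:ℝ)) (fun _ => N)) (volume.prod volume) :=
    hF.continuousOn.integrableOn_compact (isCompact_Icc.prod isCompact_Icc)
  have h := hmp.setIntegral_preimage_emb (MeasurableEquiv.measurableEmbedding _)
    (fun z : ℝ × (Fin k → ℝ) => F z.1 z.2)
    (Set.Icc 0 N ×ˢ Set.Icc (fun _ : Fin k => (0:ℝ)) (fun _ => N))
  rw [← hpre] at h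
  refine Eq.trans ?_ (h.trans ?_)
  · rfl
  · rw [Measure.volume_eq_prod, ← Measure.prod_restrict]
    rw [IntegrableOn, ← Measure.prod_restrict] at hint
    exact integral_prod_symm _ hint

theorem setIntegral_cube_comp_prod {N : ℝ} (hN : 0 < N) (k : ℕ) {f : ℝ → ℝ} (hf : Continuous f)
    (c : ℝ) :
    (∫ t in Set.Icc (fun _ : Fin k => (0:ℝ)) (fun _ => N), f (c * ∏ i, t i)) =
      N ^ k * (H^[k] f) (c * N ^ k) := by
  induction k generalizing f c with
  | zero => simp [measureReal_def, Real.volume_Icc_pi]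
  | succ k ih =>
    have hF : Continuous fun z : ℝ × (Fin k → ℝ) => f (c * (z.1 * ∏ i, z.2 i)) := by fun_prop
    simp only [Fin.prod_univ_succ]
    rw [setIntegral_Icc_fin_succ (F := fun s t => f (c * (s * ∏ i, t i))) hF]
    have hinner (t : Fin k → ℝ) : ∫ s in Set.Icc 0 N, f (c * (s * ∏ i, t i)) =
        N * H f (c * N * ∏ i, t i) := by
      rw [integral_Icc_eq_integral_Ioc, ← intervalIntegral.integral_of_le hN.le,
        mul_right_comm, ← integral_comp_mul_eq_mul_H]
      simp only [mul_assoc, mul_comm (∏ i, t i)]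
    simp only [hinner]
    rw [integral_const_mul, ih (continuous_H hf), Function.iterate_succ_apply, pow_succ']
    simp only [mul_assoc]

/-- For every integer `k ≥ 1` and every `N > 0`, the integral of `g (t₁ ⋯ t_k)` over the
cube `[0, N]^k` equals `∫₀^{N^k} H^(k-1) F (u) du`, where `F = g`. -/
theorem cube_integral_eq_iterated_average (k : ℕ) (hk : 1 ≤ k) (N : ℝ) (hN : 0 < N) :
    (∫ t in Set.Icc (fun _ : Fin k => (0:ℝ)) (fun _ : Fin k => N), g (∏ i, t i)) =
      ∫ u in (0:ℝ)..(N ^ k), (H^[k - 1] g) u := by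
  obtain ⟨m, rfl⟩ := Nat.exists_eq_add_of_le' hk
  have hg : Continuous g := g_eq_sinc ▸ Real.continuous_sinc
  have h := setIntegral_cube_comp_prod hN (m + 1) hg 1
  simp only [one_mul] at h
  rw [h, Function.iterate_succ_apply', mul_H_self, Nat.add_sub_cancel]
end

section
/- Fix an integer k ≥ 2 and constants 0 < c₁ < C₁. There exists a constant c' > 0 (depending only on k, c₁, C₁) such that for all sufficiently large real N, every compact convex set D ⊂ ℝ^k satisfying [-c₁N,c₁N]^k ⊆ D ⊆ [-C₁N,C₁N]^k obeys: the integral of g(t_1·t_2·⋯·t_k) over D with respect to Lebesgue measure is at least c'·(log N)^{k-1}. -/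
open MeasureTheory Real

/-- The sine integral. -/
noncomputable def sinInt (x : ℝ) : ℝ := ∫ t in (0 : ℝ)..x, sinc t

theorem hasDerivAt_sinInt (x : ℝ) : HasDerivAt sinInt (sinc x) x :=
  intervalIntegral.integral_hasDerivAt_right (continuous_sinc.intervalIntegrable _ _)
    (continuous_sinc.stronglyMeasurableAtFilter _ _) continuous_sinc.continuousAt

theorem sinInt_zero : sinInt 0 = 0 := by simp [sinInt]

theorem sinInt_neg (x : ℝ) : sinInt (-x) = -sinInt x := by
  have h := intervalIntegral.integral_comp_neg (f := sinc) (a := 0) (b := x)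
  simp only [sinc_neg, neg_zero] at h
  rw [sinInt, sinInt, h, intervalIntegral.integral_symm]

theorem three_quarters_le_sinc {x : ℝ} (h0 : 0 ≤ x) (h1 : x ≤ 1) : 3 / 4 ≤ sinc x := by
  rcases h0.eq_or_lt with rfl | h0
  · norm_num
  · rw [sinc_of_ne_zero h0.ne', le_div_iff₀ h0]
    have := sin_gt_sub_cube h0
    nlinarith [mul_nonneg h0.le (sub_nonneg.2 h1), mul_nonneg h0.le h0.le]

theorem mul_le_sinInt {x : ℝ} (h0 : 0 ≤ x) (h1 : x ≤ 1) : 3 / 4 * x ≤ sinInt x := by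
  have := intervalIntegral.integral_mono_on (μ := volume) (f := fun _ => (3 / 4 : ℝ)) (g := sinc) h0
    intervalIntegrable_const (continuous_sinc.intervalIntegrable _ _)
    fun t ht => three_quarters_le_sinc ht.1 (ht.2.trans h1)
  rwa [intervalIntegral.integral_const, sub_zero, smul_eq_mul, mul_comm] at this

theorem sinInt_le_self {x : ℝ} (h0 : 0 ≤ x) : sinInt x ≤ x := by
  have := intervalIntegral.integral_mono_on (μ := volume) (g := fun _ => (1 : ℝ)) (f := sinc) h0
    (continuous_sinc.intervalIntegrable _ _) intervalIntegrable_const fun t _ => sinc_le_one t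
  simpa [sinInt] using this

theorem hasDerivAt_sinInt_sub {x : ℝ} (hx : x ≠ 0) :
    HasDerivAt (fun y => sinInt y - (1 - cos y) / y) ((1 - cos x) / x ^ 2) x := by
  have h := (hasDerivAt_sinInt x).sub
    (((hasDerivAt_const x (1 : ℝ)).sub (hasDerivAt_cos x)).div (hasDerivAt_id x) hx)
  refine h.congr_deriv ?_
  rw [sinc_of_ne_zero hx]
  simp only [id, Pi.sub_apply]
  field_simp
  ring

theorem quarter_le_sinInt {x : ℝ} (hx : 1 ≤ x) : 1 / 4 ≤ sinInt x := by
  have hd : ∀ y ∈ Set.Ici (1 : ℝ), HasDerivAt (fun y => sinInt y - (1 - cos y) / y)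
      ((1 - cos y) / y ^ 2) y := fun y hy =>
    hasDerivAt_sinInt_sub (zero_lt_one.trans_le hy).ne'
  have hmono : MonotoneOn (fun y => sinInt y - (1 - cos y) / y) (Set.Ici 1) := by
    refine monotoneOn_of_hasDerivWithinAt_nonneg (convex_Ici 1)
      (fun y hy => (hd y hy).continuousAt.continuousWithinAt)
      (fun y hy => (hd y (interior_subset hy)).hasDerivWithinAt) fun y _ => ?_
    have := cos_le_one y
    exact div_nonneg (sub_nonneg.2 this) (sq_nonneg y)
  have h := hmono (Set.mem_Ici.2 le_rfl) (Set.mem_Ici.2 hx) hx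
  have h1 := mul_le_sinInt zero_le_one le_rfl
  have h2 := one_sub_sq_div_two_le_cos (x := 1)
  have h3 : 0 ≤ (1 - cos x) / x :=
    div_nonneg (sub_nonneg.2 (cos_le_one x)) (by linarith)
  simp only [div_one] at h
  linarith

theorem sinInt_nonneg {x : ℝ} (hx : 0 ≤ x) : 0 ≤ sinInt x := by
  rcases le_total x 1 with h | h
  · have := mul_le_sinInt hx h
    linarith
  · have := quarter_le_sinInt h
    linarith

theorem sinInt_le_three {x : ℝ} (hx : 0 ≤ x) : sinInt x ≤ 3 := by
  rcases le_total x 1 with h1 | h1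
  · linarith [sinInt_le_self hx]
  have hd : ∀ y ∈ Set.Ici (1 : ℝ), HasDerivAt (fun y => sinInt y - (1 - cos y) / y + 2 * y⁻¹)
      ((1 - cos y) / y ^ 2 + 2 * -(y ^ 2)⁻¹) y := fun y hy => by
    have hy0 : y ≠ 0 := (zero_lt_one.trans_le hy).ne'
    exact (hasDerivAt_sinInt_sub hy0).add ((hasDerivAt_inv hy0).const_mul 2)
  have hanti : AntitoneOn (fun y => sinInt y - (1 - cos y) / y + 2 * y⁻¹) (Set.Ici 1) := by
    refine antitoneOn_of_hasDerivWithinAt_nonpos (convex_Ici 1)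
      (fun y hy => (hd y hy).continuousAt.continuousWithinAt)
      (fun y hy => (hd y (interior_subset hy)).hasDerivWithinAt) fun y _ => ?_
    have := neg_one_le_cos y
    have h : (1 - cos y) / y ^ 2 + 2 * -(y ^ 2)⁻¹ = -((1 + cos y) / y ^ 2) := by ring
    rw [h, neg_nonpos]
    exact div_nonneg (by linarith) (sq_nonneg y)
  have h := hanti (Set.mem_Ici.2 le_rfl) (Set.mem_Ici.2 h1) h1
  have h2 := sinInt_le_self zero_le_one
  have h3 : (1 - cos x) / x ≤ 2 * x⁻¹ := by
    rw [div_eq_mul_inv]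
    have := neg_one_le_cos x
    gcongr
    linarith
  have h4 := cos_le_one 1
  simp only [div_one, inv_one] at h
  linarith

theorem abs_sinInt_le (x : ℝ) : |sinInt x| ≤ 3 := by
  rcases le_total 0 x with h | h
  · rw [abs_of_nonneg (sinInt_nonneg h)]
    exact sinInt_le_three h
  · rw [← neg_neg x, sinInt_neg, abs_neg, abs_of_nonneg (sinInt_nonneg (neg_nonneg.2 h))]
    exact sinInt_le_three (neg_nonneg.2 h)

theorem integral_sinc_mul_s6 (a b : ℝ) {m : ℝ} (hm : m ≠ 0) :
    ∫ s in a..b, sinc (s * m) = m⁻¹ * (sinInt (b * m) - sinInt (a * m)) := by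
  rw [intervalIntegral.integral_comp_mul_right _ hm, smul_eq_mul, sinInt, sinInt,
    intervalIntegral.integral_interval_sub_left (continuous_sinc.intervalIntegrable _ _)
      (continuous_sinc.intervalIntegrable _ _)]

theorem integral_sinc_mul_nonneg_s6 {b : ℝ} (hb : 0 ≤ b) (m : ℝ) :
    0 ≤ ∫ s in (0 : ℝ)..b, sinc (s * m) := by
  wlog hm : 0 ≤ m generalizing m
  · simpa [sinc_neg] using this (-m) (by linarith)
  rcases hm.eq_or_lt with rfl | hm
  · simpa using hb
  · rw [integral_sinc_mul_s6 _ _ hm.ne', zero_mul, sinInt_zero, sub_zero]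
    exact mul_nonneg (inv_nonneg.2 hm.le) (sinInt_nonneg (mul_nonneg hb hm.le))

theorem integral_sinc_mul_left_nonneg {a : ℝ} (ha : a ≤ 0) (m : ℝ) :
    0 ≤ ∫ s in a..0, sinc (s * m) := by
  have h := intervalIntegral.integral_comp_neg (f := fun s => sinc (s * m)) (a := a) (b := 0)
  simp only [neg_mul, sinc_neg, neg_zero] at h
  rw [h]
  exact integral_sinc_mul_nonneg_s6 (neg_nonneg.2 ha) m

theorem integral_sinc_mul_split (a b m : ℝ) :
    ∫ s in a..b, sinc (s * m) =
      (∫ s in a..0, sinc (s * m)) + ∫ s in (0 : ℝ)..b, sinc (s * m) := by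
  have hc : Continuous fun s => sinc (s * m) := continuous_sinc.comp (by fun_prop)
  exact (intervalIntegral.integral_add_adjacent_intervals (hc.intervalIntegrable _ _)
    (hc.intervalIntegrable _ _)).symm

theorem setIntegral_sinc_mul_eq {I : Set ℝ} (hI : IsCompact I) (hconv : Convex ℝ I)
    (hne : I.Nonempty) : ∃ a b, a ≤ b ∧ I = Set.Icc a b ∧
      ∀ m : ℝ, ∫ s in I, sinc (s * m) = ∫ s in a..b, sinc (s * m) := by
  have hIcc := eq_Icc_of_connected_compact ⟨hne, hconv.isPreconnected⟩ hI
  have hle : sInf I ≤ sSup I := Set.nonempty_Icc.1 (hIcc ▸ hne)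
  refine ⟨sInf I, sSup I, hle, hIcc, fun m => ?_⟩
  rw [intervalIntegral.integral_of_le hle, ← integral_Icc_eq_integral_Ioc, ← hIcc]

theorem setIntegral_sinc_mul_nonneg {I : Set ℝ} (hI : IsCompact I) (hconv : Convex ℝ I)
    (h0 : 0 ∈ I) (m : ℝ) : 0 ≤ ∫ s in I, sinc (s * m) := by
  obtain ⟨a, b, -, rfl, h⟩ := setIntegral_sinc_mul_eq hI hconv ⟨0, h0⟩
  rw [h, integral_sinc_mul_split]
  exact add_nonneg (integral_sinc_mul_left_nonneg h0.1 m) (integral_sinc_mul_nonneg_s6 h0.2 m)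

theorem quarter_mul_inv_le_setIntegral_sinc_mul {I : Set ℝ} (hI : IsCompact I)
    (hconv : Convex ℝ I) (h0 : 0 ∈ I) {m b : ℝ} (hb : b ∈ I) (hm : 0 < m) (hbm : 1 ≤ b * m) :
    1 / 4 * m⁻¹ ≤ ∫ s in I, sinc (s * m) := by
  obtain ⟨a, c, -, rfl, h⟩ := setIntegral_sinc_mul_eq hI hconv ⟨0, h0⟩
  rw [h, integral_sinc_mul_split, integral_sinc_mul_s6 0 c hm.ne', zero_mul, sinInt_zero, sub_zero]
  have h1 : 1 / 4 ≤ sinInt (c * m) :=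
    quarter_le_sinInt (hbm.trans (mul_le_mul_of_nonneg_right hb.2 hm.le))
  have h2 := mul_le_mul_of_nonneg_left h1 (inv_nonneg.2 hm.le)
  have h3 := integral_sinc_mul_left_nonneg h0.1 m
  linarith

theorem abs_setIntegral_sinc_mul_le {I : Set ℝ} (hI : IsCompact I) (hconv : Convex ℝ I)
    {m : ℝ} (hm : m ≠ 0) : |∫ s in I, sinc (s * m)| ≤ 6 * |m|⁻¹ := by
  rcases I.eq_empty_or_nonempty with rfl | hne
  · simp
  obtain ⟨a, b, -, -, h⟩ := setIntegral_sinc_mul_eq hI hconv hne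
  rw [h, integral_sinc_mul_s6 _ _ hm, abs_mul, abs_inv, mul_comm]
  gcongr
  have h1 := abs_sub (sinInt (b * m)) (sinInt (a * m))
  linarith [abs_sinInt_le (b * m), abs_sinInt_le (a * m)]

theorem abs_setIntegral_sinc_mul_le_length {I : Set ℝ} {r : ℝ} (hr : 0 ≤ r)
    (hI : I ⊆ Set.Icc (-r) r) (m : ℝ) : |∫ s in I, sinc (s * m)| ≤ 2 * r := by
  have hvol : volume I ≤ ENNReal.ofReal (2 * r) := by
    refine (measure_mono hI).trans_eq ?_
    rw [Real.volume_Icc]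
    congr 1
    ring
  have h := norm_setIntegral_le_of_norm_le_const (f := fun s => sinc (s * m)) (C := 1)
    (hvol.trans_lt ENNReal.ofReal_lt_top) fun s _ => abs_sinc_le_one _
  rw [one_mul, Real.norm_eq_abs] at h
  exact h.trans (ENNReal.toReal_le_of_le_ofReal (by linarith) hvol)

/-- Interpolation between the two trivial bounds, with exponent `δ` chosen so that
`(2 * r) ^ δ = e`. -/
theorem abs_setIntegral_sinc_mul_le_rpow {I : Set ℝ} (hI : IsCompact I) (hconv : Convex ℝ I)
    {r δ : ℝ} (hr : 0 < r) (hIr : I ⊆ Set.Icc (-r) r) (hδ0 : 0 ≤ δ) (hδ1 : δ ≤ 1)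
    (hδ : (2 * r) ^ δ = exp 1) {m : ℝ} (hm : m ≠ 0) :
    |∫ s in I, sinc (s * m)| ≤ 6 * exp 1 * |m| ^ (δ - 1) := by
  set x := |∫ s in I, sinc (s * m)|
  have h1 : x ≤ 6 * |m|⁻¹ := abs_setIntegral_sinc_mul_le hI hconv hm
  have h2 : x ≤ 2 * r := abs_setIntegral_sinc_mul_le_length hr.le hIr m
  have hx : 0 ≤ x := abs_nonneg _
  have hm' : 0 < |m| := abs_pos.2 hm
  calc x = x ^ (1 - δ) * x ^ δ := by
        rw [← rpow_add' hx (by norm_num)]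
        norm_num
    _ ≤ (6 * |m|⁻¹) ^ (1 - δ) * (2 * r) ^ δ := by
        gcongr
    _ = 6 ^ (1 - δ) * exp 1 * |m| ^ (δ - 1) := by
        rw [hδ, mul_rpow (by norm_num) (by positivity), inv_rpow hm'.le, ← rpow_neg hm'.le,
          neg_sub]
        ring
    _ ≤ 6 * exp 1 * |m| ^ (δ - 1) := by
        gcongr
        exact rpow_le_self_of_one_le (by norm_num) (by linarith)

theorem integrable_comp_abs {f : ℝ → ℝ} (hf : IntegrableOn f (Set.Ioi 0)) :
    Integrable fun t => f |t| := by
  have hpos : IntegrableOn (fun t => f |t|) (Set.Ioi 0) :=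
    hf.congr_fun (fun t ht => by simp only [abs_of_pos (Set.mem_Ioi.1 ht)]) measurableSet_Ioi
  have hneg : IntegrableOn (fun t => f |t|) (Set.Iic 0) := by
    have h := (integrableOn_Ici_iff_integrableOn_Ioi (b := (0 : ℝ))).2 hpos
    rw [← (Measure.measurePreserving_neg volume).integrableOn_comp_preimage
      (Homeomorph.neg ℝ).measurableEmbedding] at h
    simpa [Function.comp_def] using h
  rw [← integrableOn_univ, ← Set.Iic_union_Ioi (a := (0 : ℝ))]
  exact hneg.union hpos

theorem integrable_indicator_abs_rpow {r δ : ℝ} (hr : 0 ≤ r) (hδ : 0 < δ) :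
    Integrable (fun t : ℝ => (Set.Iic r).indicator (fun u => u ^ (δ - 1)) |t|) ∧
    ∫ t : ℝ, (Set.Iic r).indicator (fun u => u ^ (δ - 1)) |t| = 2 * (r ^ δ / δ) := by
  constructor
  · have h : IntegrableOn (fun u => (Set.Iic r).indicator (fun u => u ^ (δ - 1)) u)
        (Set.Ioi (0 : ℝ)) := by
      rw [IntegrableOn, integrable_indicator_iff measurableSet_Iic, IntegrableOn,
        Measure.restrict_restrict measurableSet_Iic, Set.Iic_inter_Ioi]
      exact (intervalIntegrable_iff_integrableOn_Ioc_of_le hr).1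
        (intervalIntegral.intervalIntegrable_rpow' (by linarith))
    exact integrable_comp_abs h
  · rw [integral_comp_abs (f := (Set.Iic r).indicator (fun u => u ^ (δ - 1))),
      setIntegral_indicator measurableSet_Iic, Set.Ioi_inter_Iic,
      ← intervalIntegral.integral_of_le hr, integral_rpow (Or.inl (by linarith))]
    simp [zero_rpow hδ.ne']

theorem integrable_indicator_Ioc_abs_rpow {r₀ r δ : ℝ} (hr₀ : 0 < r₀) (hr : r₀ ≤ r)
    (hδ : 0 < δ) (hδ1 : δ ≤ 1) :
    Integrable (fun t : ℝ => (Set.Ioc r₀ r).indicator (fun u => u ^ (δ - 1)) |t|) ∧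
    ∫ t : ℝ, (Set.Ioc r₀ r).indicator (fun u => u ^ (δ - 1)) |t| ≤
      2 * (r₀ ^ (δ - 1) * (r - r₀)) := by
  have hint : IntegrableOn (fun u : ℝ => u ^ (δ - 1)) (Set.Ioc r₀ r) :=
    (intervalIntegrable_iff_integrableOn_Ioc_of_le hr).1
      (intervalIntegral.intervalIntegrable_rpow' (by linarith))
  have hsub : Set.Ioc r₀ r ∩ Set.Ioi 0 = Set.Ioc r₀ r :=
    Set.inter_eq_left.2 fun u hu => hr₀.trans hu.1
  constructor
  · have h : IntegrableOn (fun u => (Set.Ioc r₀ r).indicator (fun u => u ^ (δ - 1)) u)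
        (Set.Ioi (0 : ℝ)) := by
      rwa [IntegrableOn, integrable_indicator_iff measurableSet_Ioc, IntegrableOn,
        Measure.restrict_restrict measurableSet_Ioc, hsub]
    exact integrable_comp_abs h
  · rw [integral_comp_abs (f := (Set.Ioc r₀ r).indicator (fun u => u ^ (δ - 1))),
      setIntegral_indicator measurableSet_Ioc, Set.inter_comm, hsub]
    gcongr
    have h := setIntegral_mono_on (g := fun _ => r₀ ^ (δ - 1)) hint (by simp) measurableSet_Ioc
      fun u hu => rpow_le_rpow_of_nonpos hr₀ hu.1.le (by linarith)
    simpa [hr, mul_comm] using h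

theorem integrable_indicator_inv {r : ℝ} (hr : 1 ≤ r) :
    Integrable ((Set.Icc 1 r).indicator fun t : ℝ => t⁻¹) ∧
    ∫ t : ℝ, (Set.Icc 1 r).indicator (fun t => t⁻¹) t = log r := by
  constructor
  · rw [integrable_indicator_iff measurableSet_Icc]
    refine ContinuousOn.integrableOn_Icc (continuousOn_id.inv₀ fun t ht => ?_)
    exact (zero_lt_one.trans_le ht.1).ne'
  · rw [integral_indicator measurableSet_Icc, integral_Icc_eq_integral_Ioc,
      ← intervalIntegral.integral_of_le hr, integral_inv_of_pos one_pos (by linarith), div_one]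

theorem prod_ite_eq_mul_pow {n : ℕ} (j : Fin n) (a b : ℝ) :
    ∏ i, (if i = j then a else b) = a * b ^ (n - 1) := by
  rw [← Finset.mul_prod_erase _ _ (Finset.mem_univ j), if_pos rfl]
  congr 1
  rw [Finset.prod_congr rfl fun i hi => if_neg (Finset.ne_of_mem_erase hi)]
  simp
theorem eventually_log_pow_le {c₁ C₁ A : ℝ} (hc₁ : 0 < c₁) (hC₁ : 0 < C₁) (hA : 0 ≤ A) (p : ℕ) :
    ∀ᶠ N : ℝ in Filter.atTop, 0 < N ∧ 1 ≤ c₁ * N ∧ 1 ≤ log (2 * (C₁ * N)) ∧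
      1 / 2 ^ (p + 4) * log N ^ (p + 1) ≤
        1 / 4 * log (c₁ * N) ^ (p + 1) - A * log (2 * (C₁ * N)) ^ p := by
  have hL := tendsto_log_atTop
  filter_upwards [Filter.eventually_gt_atTop 0, Filter.eventually_ge_atTop c₁⁻¹,
    hL.eventually_ge_atTop (2 * |log c₁|), hL.eventually_ge_atTop |log (2 * C₁)|,
    hL.eventually_ge_atTop (1 + |log (2 * C₁)|),
    hL.eventually_ge_atTop (A * 2 ^ p * 2 ^ (p + 4))] with N hN h1 h2 h3 h4 h5
  have e1 : log (c₁ * N) = log c₁ + log N := log_mul hc₁.ne' hN.ne'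
  have e2 : log (2 * (C₁ * N)) = log (2 * C₁) + log N := by
    rw [← mul_assoc, log_mul (by positivity) hN.ne']
  have a1 := neg_abs_le (log c₁)
  have a2 := neg_abs_le (log (2 * C₁))
  have a3 := le_abs_self (log (2 * C₁))
  have hL0 : 0 ≤ log N := le_trans (abs_nonneg _) h3
  refine ⟨hN, (inv_le_iff_one_le_mul₀' hc₁).1 h1, by linarith, ?_⟩
  have b1 : (log N / 2) ^ (p + 1) ≤ log (c₁ * N) ^ (p + 1) := by
    gcongr
    linarith
  have b2 : A * log (2 * (C₁ * N)) ^ p ≤ A * (2 * log N) ^ p := by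
    gcongr
    · linarith
    · linarith
  have b3 : A * (2 * log N) ^ p ≤ 1 / 2 ^ (p + 4) * log N ^ (p + 1) := by
    calc A * (2 * log N) ^ p = 1 / 2 ^ (p + 4) * ((A * 2 ^ p * 2 ^ (p + 4)) * log N ^ p) := by
          field_simp
          rw [mul_pow, mul_assoc]
      _ ≤ 1 / 2 ^ (p + 4) * (log N * log N ^ p) := by gcongr
      _ = _ := by ring
  have b4 : 1 / 4 * (log N / 2) ^ (p + 1) = 2 * (1 / 2 ^ (p + 4) * log N ^ (p + 1)) := by
    rw [div_pow]
    field_simp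
    ring
  linarith

section Slices

variable {n : ℕ} {D : Set (Fin (n + 1) → ℝ)} {r₀ r δ : ℝ}

theorem convex_slice (hD : Convex ℝ D) (x : Fin n → ℝ) :
    Convex ℝ {s : ℝ | (Fin.cons s x : Fin (n + 1) → ℝ) ∈ D} := by
  intro s hs t ht a b ha hb hab
  have h := hD hs ht ha hb hab
  have e : a • (Fin.cons s x : Fin (n + 1) → ℝ) + b • (Fin.cons t x : Fin (n + 1) → ℝ) =
      Fin.cons (a • s + b • t) x := by
    funext i
    refine Fin.cases ?_ (fun i => ?_) i
    · simp
    · simp [← add_mul, hab]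
  rwa [e] at h

theorem slice_subset (hDr : D ⊆ Set.Icc (fun _ => -r) fun _ => r) (x : Fin n → ℝ) :
    {s : ℝ | (Fin.cons s x : Fin (n + 1) → ℝ) ∈ D} ⊆ Set.Icc (-r) r := fun s hs => by
  have h := hDr hs
  exact ⟨by simpa using h.1 0, by simpa using h.2 0⟩

theorem continuous_fin_cons (x : Fin n → ℝ) :
    Continuous fun s : ℝ => (Fin.cons s x : Fin (n + 1) → ℝ) :=
  continuous_pi <| Fin.cases continuous_id fun _ => continuous_const

theorem isCompact_slice (hD : IsCompact D) (hDr : D ⊆ Set.Icc (fun _ => -r) fun _ => r)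
    (x : Fin n → ℝ) : IsCompact {s : ℝ | (Fin.cons s x : Fin (n + 1) → ℝ) ∈ D} :=
  isCompact_Icc.of_isClosed_subset (hD.isClosed.preimage (continuous_fin_cons x)) (slice_subset hDr x)

theorem mem_slice (hr₀D : Set.Icc (fun _ => -r₀) (fun _ => r₀) ⊆ D) {x : Fin n → ℝ}
    (hx : ∀ i, |x i| ≤ r₀) {s : ℝ} (hs : |s| ≤ r₀) : (Fin.cons s x : Fin (n + 1) → ℝ) ∈ D := by
  refine hr₀D ⟨fun i => ?_, fun i => ?_⟩
  · refine Fin.cases ?_ (fun i => ?_) i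
    · simpa using (abs_le.1 hs).1
    · simpa using (abs_le.1 (hx i)).1
  · refine Fin.cases ?_ (fun i => ?_) i
    · simpa using (abs_le.1 hs).2
    · simpa using (abs_le.1 (hx i)).2

theorem lower_bound_slice (hD : IsCompact D) (hconv : Convex ℝ D)
    (hr₀D : Set.Icc (fun _ => -r₀) (fun _ => r₀) ⊆ D)
    (hDr : D ⊆ Set.Icc (fun _ => -r) fun _ => r)
    (hr₀ : 1 ≤ r₀) (hr : r₀ ≤ r) (hδ0 : 0 ≤ δ) (hδ1 : δ ≤ 1) (hδ : (2 * r) ^ δ = exp 1)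
    (x : Fin n → ℝ) :
    1 / 4 * ∏ i, (Set.Icc 1 r₀).indicator (fun t => t⁻¹) (x i) -
        6 * exp 1 * ∑ j, ∏ i, (if i = j then
          (Set.Ioc r₀ r).indicator (fun u => u ^ (δ - 1)) |x i| else
          (Set.Iic r).indicator (fun u => u ^ (δ - 1)) |x i|) ≤
      ∫ s in {s : ℝ | (Fin.cons s x : Fin (n + 1) → ℝ) ∈ D}, sinc (s * ∏ i, x i) := by
  have hI := isCompact_slice hD hDr x
  have hIc := convex_slice hconv x
  have hterm : ∀ j, 0 ≤ ∏ i, (if i = j then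
      (Set.Ioc r₀ r).indicator (fun u => u ^ (δ - 1)) |x i| else
      (Set.Iic r).indicator (fun u => u ^ (δ - 1)) |x i|) := fun j => by
    refine Finset.prod_nonneg fun i _ => ?_
    split_ifs <;>
    exact Set.indicator_apply_nonneg fun _ => rpow_nonneg (abs_nonneg _) _
  have hsum := Finset.sum_nonneg fun j (_ : j ∈ Finset.univ) => hterm j
  have hpos : (0 : ℝ) < 6 * exp 1 := by positivity
  have hsum' := mul_nonneg hpos.le hsum
  have hzero : ∀ i, x i ∉ Set.Icc 1 r₀ →
      ∏ i, (Set.Icc 1 r₀).indicator (fun t => t⁻¹) (x i) = 0 := fun i hi =>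
    Finset.prod_eq_zero (Finset.mem_univ i) (Set.indicator_of_notMem hi _)
  by_cases hP : ∀ i, |x i| ≤ r₀
  · have h0 := mem_slice hr₀D hP (s := 0) (by simpa using by linarith)
    have hnn := setIntegral_sinc_mul_nonneg hI hIc h0 (∏ i, x i)
    by_cases h1 : ∀ i, 1 ≤ x i
    · have hm : 1 ≤ ∏ i, x i := by
        simpa using Finset.prod_le_prod (s := Finset.univ) (f := fun _ => (1 : ℝ)) (g := x)
          (fun _ _ => zero_le_one) fun i _ => h1 i
      have hb := mem_slice hr₀D hP (s := r₀) (abs_of_nonneg (by linarith)).le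
      have h := quarter_mul_inv_le_setIntegral_sinc_mul hI hIc h0 hb (by linarith)
        (one_le_mul_of_one_le_of_one_le hr₀ hm)
      have e : ∏ i, (Set.Icc 1 r₀).indicator (fun t => t⁻¹) (x i) = (∏ i, x i)⁻¹ := by
        rw [← Finset.prod_inv_distrib]
        exact Finset.prod_congr rfl fun i _ =>
          Set.indicator_of_mem (s := Set.Icc 1 r₀) ⟨h1 i, (le_abs_self _).trans (hP i)⟩ _
      rw [e]
      linarith
    · push Not at h1
      obtain ⟨i, hi⟩ := h1
      rw [hzero i fun h => hi.not_ge h.1]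
      linarith
  · push Not at hP
    obtain ⟨j, hj⟩ := hP
    rw [hzero j fun h => hj.not_ge ((abs_of_nonneg (zero_le_one.trans h.1)).trans_le h.2)]
    rcases eq_or_ne (∏ i, x i) 0 with hm | hm
    · have : 0 ≤ ∫ s in {s : ℝ | (Fin.cons s x : Fin (n + 1) → ℝ) ∈ D}, sinc (s * ∏ i, x i) := by
        simp [hm]
      linarith
    rcases Set.eq_empty_or_nonempty {s : ℝ | (Fin.cons s x : Fin (n + 1) → ℝ) ∈ D}
      with hemp | ⟨s, hs⟩
    · rw [hemp]
      simpa using hsum'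
    have hxr : ∀ i, |x i| ≤ r := fun i => by
      have h := hDr hs
      exact abs_le.2 ⟨by simpa using h.1 i.succ, by simpa using h.2 i.succ⟩
    have h := abs_setIntegral_sinc_mul_le_rpow hI hIc (by linarith) (slice_subset hDr x)
      hδ0 hδ1 hδ hm
    have e : ∏ i, (if i = j then
        (Set.Ioc r₀ r).indicator (fun u => u ^ (δ - 1)) |x i| else
        (Set.Iic r).indicator (fun u => u ^ (δ - 1)) |x i|) = |∏ i, x i| ^ (δ - 1) := by
      rw [Finset.abs_prod, ← finsetProd_rpow _ _ fun i _ => abs_nonneg _]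
      refine Finset.prod_congr rfl fun i _ => ?_
      split_ifs with hij
      · subst hij
        exact Set.indicator_of_mem (s := Set.Ioc r₀ r) ⟨hj, hxr i⟩ _
      · exact Set.indicator_of_mem (s := Set.Iic r) (hxr i) _
    have hle := Finset.single_le_sum (fun j _ => hterm j) (Finset.mem_univ j)
    rw [e] at hle
    have := mul_le_mul_of_nonneg_left hle hpos.le
    linarith [neg_abs_le (∫ s in {s : ℝ | (Fin.cons s x : Fin (n + 1) → ℝ) ∈ D},
      sinc (s * ∏ i, x i))]

theorem integral_slices (hD : IsCompact D) :
    Integrable (fun x : Fin n → ℝ =>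
      ∫ s in {s : ℝ | (Fin.cons s x : Fin (n + 1) → ℝ) ∈ D}, sinc (s * ∏ i, x i)) ∧
    ∫ t in D, sinc (∏ i, t i) = ∫ x : Fin n → ℝ,
      ∫ s in {s : ℝ | (Fin.cons s x : Fin (n + 1) → ℝ) ∈ D}, sinc (s * ∏ i, x i) := by
  set F : (Fin (n + 1) → ℝ) → ℝ := D.indicator fun t => sinc (∏ i, t i) with hF
  let e := MeasurableEquiv.piFinSuccAbove (fun _ : Fin (n + 1) => ℝ) 0
  have he : MeasurePreserving e.symm :=
    (volume_preserving_piFinSuccAbove (fun _ : Fin (n + 1) => ℝ) 0).symm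
  have hint : Integrable F := by
    rw [hF, integrable_indicator_iff hD.measurableSet]
    exact (continuous_sinc.comp (by fun_prop)).continuousOn.integrableOn_compact hD
  have hint' : Integrable (fun z => F (e.symm z)) (volume.prod volume) :=
    (he.integrable_comp_emb e.symm.measurableEmbedding).2 hint
  have hinner : ∀ x : Fin n → ℝ, ∫ s, F (e.symm (s, x)) =
      ∫ s in {s : ℝ | (Fin.cons s x : Fin (n + 1) → ℝ) ∈ D}, sinc (s * ∏ i, x i) := fun x => by
    have hmeas : MeasurableSet {s : ℝ | (Fin.cons s x : Fin (n + 1) → ℝ) ∈ D} :=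
      (continuous_fin_cons x).measurable hD.measurableSet
    rw [← integral_indicator hmeas]
    congr with s
    have hs : e.symm (s, x) = Fin.cons s x := by
      simp [e, MeasurableEquiv.piFinSuccAbove, Fin.consEquiv]
    rw [hs, hF]
    simp [Set.indicator, Fin.prod_univ_succ]
  constructor
  · have h := hint'.integral_prod_right
    simpa only [hinner] using h
  · rw [← integral_indicator hD.measurableSet, ← he.integral_comp' F]
    have h := integral_prod_symm _ hint'
    simp only [hinner] at h
    exact h

theorem lower_bound_of_box (hD : IsCompact D) (hconv : Convex ℝ D)
    (hr₀D : Set.Icc (fun _ => -r₀) (fun _ => r₀) ⊆ D)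
    (hDr : D ⊆ Set.Icc (fun _ => -r) fun _ => r)
    (hr₀ : 1 ≤ r₀) (hr : r₀ ≤ r) (hlog : 1 ≤ log (2 * r)) :
    1 / 4 * log r₀ ^ n -
        6 * exp 1 * (n * (2 * exp 1 * (r / r₀) * (2 * exp 1 * log (2 * r)) ^ (n - 1))) ≤
      ∫ t in D, sinc (∏ i, t i) := by
  set δ := (log (2 * r))⁻¹ with hδdef
  have hr₀0 : 0 < r₀ := by linarith
  have hr0 : 0 < r := by linarith
  have hδ0 : 0 < δ := inv_pos.2 (by linarith)
  have hδ1 : δ ≤ 1 := inv_le_one_of_one_le₀ hlog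
  have hδ : (2 * r) ^ δ = exp 1 := by
    rw [rpow_def_of_pos (by linarith), hδdef, mul_inv_cancel₀ (by linarith)]
  have hpow : ∀ u, 0 ≤ u → u ≤ 2 * r → u ^ δ ≤ exp 1 := fun u h0 h =>
    hδ ▸ rpow_le_rpow h0 h hδ0.le
  obtain ⟨ha, ha'⟩ := integrable_indicator_inv hr₀
  obtain ⟨hb, hb'⟩ := integrable_indicator_Ioc_abs_rpow hr₀0 hr hδ0 hδ1
  obtain ⟨hc, hc'⟩ := integrable_indicator_abs_rpow hr0.le hδ0
  have hA : Integrable fun x : Fin n → ℝ =>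
      ∏ i, (Set.Icc 1 r₀).indicator (fun t => t⁻¹) (x i) := Integrable.fintype_prod fun _ => ha
  let f : Fin n → Fin n → ℝ → ℝ := fun j i t => if i = j then
    (Set.Ioc r₀ r).indicator (fun u => u ^ (δ - 1)) |t| else
    (Set.Iic r).indicator (fun u => u ^ (δ - 1)) |t|
  have hB : ∀ j, Integrable fun x : Fin n → ℝ => ∏ i, f j i (x i) := fun j =>
    Integrable.fintype_prod fun i => by
      by_cases hij : i = j
      · simpa only [f, if_pos hij] using hb
      · simpa only [f, if_neg hij] using hc
  have hBle : ∀ j, ∫ x : Fin n → ℝ, ∏ i, f j i (x i) ≤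
      2 * exp 1 * (r / r₀) * (2 * exp 1 * log (2 * r)) ^ (n - 1) := fun j => by
    have hf : ∀ i, ∫ t, f j i t = if i = j then
        ∫ t : ℝ, (Set.Ioc r₀ r).indicator (fun u => u ^ (δ - 1)) |t| else
        ∫ t : ℝ, (Set.Iic r).indicator (fun u => u ^ (δ - 1)) |t| := fun i => by
      by_cases hij : i = j <;> simp only [f, hij, if_true, if_false]
    rw [integral_fintype_prod_volume_eq_prod]
    simp only [hf]
    rw [prod_ite_eq_mul_pow, hc']
    have hb'' : 2 * (r₀ ^ (δ - 1) * (r - r₀)) ≤ 2 * exp 1 * (r / r₀) := by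
      rw [rpow_sub_one hr₀0.ne']
      calc 2 * (r₀ ^ δ / r₀ * (r - r₀)) ≤ 2 * (exp 1 / r₀ * r) := by
            gcongr
            · exact hpow r₀ hr₀0.le (by linarith)
            · linarith
        _ = _ := by ring
    have hc'' : 2 * (r ^ δ / δ) ≤ 2 * exp 1 * log (2 * r) := by
      rw [hδdef, div_inv_eq_mul, mul_assoc]
      gcongr
      exact hpow r hr0.le (by linarith)
    have hc0 : 0 ≤ 2 * (r ^ δ / δ) := by positivity
    gcongr
    exact hb'.trans hb''
  obtain ⟨hint, heq⟩ := integral_slices hD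
  rw [heq]
  have hS : Integrable fun x : Fin n → ℝ => ∑ j, ∏ i, f j i (x i) :=
    integrable_finsetSum _ fun j _ => hB j
  refine le_trans ?_ (integral_mono ((hA.const_mul (1 / 4)).sub (hS.const_mul (6 * exp 1))) hint
    fun x => lower_bound_slice hD hconv hr₀D hDr hr₀ hr hδ0.le hδ1 hδ x)
  simp only [Pi.sub_apply]
  rw [integral_sub (hA.const_mul _) (hS.const_mul _), integral_const_mul, integral_const_mul,
    integral_fintype_prod_volume_eq_pow, ha', Fintype.card_fin,
    integral_finsetSum _ fun j _ => hB j]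
  gcongr
  have := Finset.sum_le_card_nsmul Finset.univ _ _ fun j _ => hBle j
  simpa using this

end Slices

/-- Fix `k ≥ 2` and `0 < c₁ < C₁`. There is `c' > 0` such that for all sufficiently large `N`,
every compact convex `D` with `[-c₁N, c₁N]^k ⊆ D ⊆ [-C₁N, C₁N]^k` satisfies
`∫_D g (t₁ ⋯ t_k) ≥ c' · (log N)^(k-1)`. -/
theorem convex_integral_lower_bound (k : ℕ) (hk : 2 ≤ k) (c₁ C₁ : ℝ)
    (hc₁ : 0 < c₁) (hcC : c₁ < C₁) :
    ∃ c' : ℝ, 0 < c' ∧ ∃ N₀ : ℝ, ∀ N : ℝ, N₀ ≤ N → ∀ D : Set (Fin k → ℝ),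
      IsCompact D → Convex ℝ D →
      Set.Icc (fun _ : Fin k => -(c₁ * N)) (fun _ : Fin k => c₁ * N) ⊆ D →
      D ⊆ Set.Icc (fun _ : Fin k => -(C₁ * N)) (fun _ : Fin k => C₁ * N) →
      c' * (Real.log N) ^ (k - 1) ≤ ∫ t in D, g (∏ i, t i) := by
  obtain ⟨p, rfl⟩ : ∃ p, k = p + 1 + 1 := ⟨k - 2, by omega⟩
  have hC₁ : 0 < C₁ := hc₁.trans hcC
  obtain ⟨N₀, hN₀⟩ := Filter.eventually_atTop.1 (eventually_log_pow_le hc₁ hC₁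
    (A := 6 * exp 1 * ((p + 1 : ℕ) * (2 * exp 1 * (C₁ / c₁) * (2 * exp 1) ^ p)))
    (by positivity) p)
  refine ⟨1 / 2 ^ (p + 4), by positivity, N₀, fun N hN D hD hconv hsub hsup => ?_⟩
  obtain ⟨hN0, h1, h2, h3⟩ := hN₀ N hN
  have h := lower_bound_of_box hD hconv hsub hsup h1 (by gcongr) h2
  have hg : g = sinc := rfl
  rw [hg]
  refine h3.trans (le_trans (le_of_eq ?_) h)
  rw [mul_div_mul_right _ _ hN0.ne', Nat.add_sub_cancel, mul_pow]
  ring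
end

section
/- For every integer k ≥ 2 there exists a constant C > 0 (depending only on k) such that for every compact convex set D ⊂ ℝ^k and every integer d ≥ 1, the absolute value of the integral of g(t_1·t_2·⋯·t_k) over the set D ∩ { t ∈ ℝ^k : 2^d < |t|_∞ ≤ 2^{d+1} } with respect to Lebesgue measure is at most C·d^{k-2}. -/
open MeasureTheory Real

open Set
open scoped ENNReal

lemma continuous_g : Continuous g := Real.continuous_sinc

lemma abs_g_le_one (u : ℝ) : |g u| ≤ 1 := Real.abs_sinc_le_one u

lemma g_neg (u : ℝ) : g (-u) = g u := Real.sinc_neg u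

/-- Oscillation estimate: integrating by parts saves a factor `p * l` over the absolute bound. -/
lemma abs_integral_g_mul_le_div {p l a b : ℝ} (hp : p ≠ 0) (hl : 0 < l) (hla : l ≤ a)
    (hab : a ≤ b) (hb : b ≤ 2 * l) : |∫ t in a..b, g (p * t)| ≤ 3 / (p ^ 2 * l) := by
  have hpos : ∀ x ∈ uIcc a b, l ≤ x := fun x hx => by
    rw [uIcc_of_le hab] at hx
    exact hla.trans hx.1
  have hderiv : ∀ x ∈ uIcc a b, HasDerivAt (fun t => -Real.cos (p * t) / (p ^ 2 * t))
      (g (p * x) + Real.cos (p * x) / (p ^ 2 * x ^ 2)) x := fun x hx => by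
    have hx0 : x ≠ 0 := (hl.trans_le (hpos x hx)).ne'
    have h1 : HasDerivAt (fun t : ℝ => p * t) p x := by
      simpa using (hasDerivAt_id x).const_mul p
    have h2 : HasDerivAt (fun t : ℝ => p ^ 2 * t) (p ^ 2) x := by
      simpa using (hasDerivAt_id x).const_mul (p ^ 2)
    refine ((h1.cos.neg).div h2 (by positivity)).congr_deriv ?_
    have hgx : g (p * x) = Real.sin (p * x) / (p * x) := if_neg (mul_ne_zero hp hx0)
    rw [hgx, Pi.neg_apply]
    field_simp
    ring
  have hg : Continuous fun x => g (p * x) := continuous_g.comp (by fun_prop)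
  have hcos : ContinuousOn (fun x : ℝ => Real.cos (p * x) / (p ^ 2 * x ^ 2)) (uIcc a b) := by
    refine ContinuousOn.div (by fun_prop) (by fun_prop) fun x hx => ?_
    have := hl.trans_le (hpos x hx)
    positivity
  have hsum := intervalIntegral.integral_eq_sub_of_hasDerivAt hderiv
    ((hg.continuousOn.add hcos).intervalIntegrable)
  rw [intervalIntegral.integral_add (hg.intervalIntegrable _ _) hcos.intervalIntegrable] at hsum
  have hpl : 0 < p ^ 2 * l := by positivity
  have hbound : ∀ x, l ≤ x → |-Real.cos (p * x) / (p ^ 2 * x)| ≤ 1 / (p ^ 2 * l) := fun x hx => by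
    have hx0 := hl.trans_le hx
    rw [abs_div, abs_neg, abs_of_pos (show 0 < p ^ 2 * x by positivity)]
    exact div_le_div₀ zero_le_one (Real.abs_cos_le_one _) hpl (by gcongr)
  have hrem : |∫ x in a..b, Real.cos (p * x) / (p ^ 2 * x ^ 2)| ≤ 1 / (p ^ 2 * l) := by
    have h := intervalIntegral.norm_integral_le_of_norm_le_const (a := a) (b := b)
      (C := 1 / (p ^ 2 * l ^ 2)) (f := fun x => Real.cos (p * x) / (p ^ 2 * x ^ 2)) fun x hx => by
        have hx' := hpos x (uIoc_subset_uIcc hx)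
        have hx0 := hl.trans_le hx'
        rw [Real.norm_eq_abs, abs_div, abs_of_pos (show 0 < p ^ 2 * x ^ 2 by positivity)]
        exact div_le_div₀ zero_le_one (Real.abs_cos_le_one _) (by positivity) (by gcongr)
    refine h.trans ?_
    rw [abs_of_nonneg (by linarith)]
    calc 1 / (p ^ 2 * l ^ 2) * (b - a) ≤ 1 / (p ^ 2 * l ^ 2) * l := by
          gcongr; linarith
      _ = 1 / (p ^ 2 * l) := by field_simp
  have ha' := abs_le.1 (hbound a hla)
  have hb' := abs_le.1 (hbound b (hla.trans hab))
  have hr' := abs_le.1 hrem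
  have : 3 / (p ^ 2 * l) = 3 * (1 / (p ^ 2 * l)) := by ring
  rw [this, abs_le]
  constructor <;> linarith

lemma abs_integral_g_mul_le {l a b : ℝ} (p : ℝ) (hl : 0 < l) (hla : l ≤ a)
    (hab : a ≤ b) (hb : b ≤ 2 * l) :
    |∫ t in a..b, g (p * t)| ≤ 4 * l * (1 + (l * p) ^ 2)⁻¹ := by
  have h1 : |∫ t in a..b, g (p * t)| ≤ l := by
    have h := intervalIntegral.norm_integral_le_of_norm_le_const (a := a) (b := b)
      (C := 1) (f := fun x => g (p * x)) fun x _ => abs_g_le_one _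
    rw [abs_of_nonneg (by linarith)] at h
    exact h.trans (by linarith)
  have h2 : |∫ t in a..b, g (p * t)| * (l * p) ^ 2 ≤ 3 * l := by
    rcases eq_or_ne p 0 with rfl | hp
    · simp [hl.le]
    · have h := abs_integral_g_mul_le_div hp hl hla hab hb
      rw [le_div_iff₀ (by positivity)] at h
      nlinarith
  rw [← div_eq_mul_inv, le_div_iff₀ (by positivity)]
  linarith

lemma Set.OrdConnected.exists_ae_eq_Ioc {S : Set ℝ} (hS : S.OrdConnected) {a b : ℝ} (hab : a ≤ b)
    (hSab : S ⊆ Icc a b) : ∃ c d, a ≤ c ∧ c ≤ d ∧ d ≤ b ∧ S =ᵐ[volume] Ioc c d := by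
  rcases S.eq_empty_or_nonempty with rfl | hne
  · exact ⟨a, a, le_rfl, le_rfl, hab, by simp⟩
  have hbb : BddBelow S := bddBelow_Icc.mono hSab
  have hba : BddAbove S := bddAbove_Icc.mono hSab
  refine ⟨sInf S, sSup S, le_csInf hne fun x hx => (hSab hx).1, csInf_le_csSup hne hbb hba,
    csSup_le hne fun x hx => (hSab hx).2, ?_⟩
  have h1 : Ioo (sInf S) (sSup S) ⊆ S :=
    IsConnected.Ioo_csInf_csSup_subset ⟨hne, hS.isPreconnected⟩ hbb hba
  have h2 : S ⊆ Icc (sInf S) (sSup S) := subset_Icc_csInf_csSup hbb hba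
  exact (h2.eventuallyLE.trans Ioc_ae_eq_Icc.symm.le).antisymm
    (Ioo_ae_eq_Ioc.symm.le.trans h1.eventuallyLE)

lemma abs_setIntegral_g_mul_le_of_subset_Icc {S : Set ℝ} (hS : S.OrdConnected) {l : ℝ} (p : ℝ)
    (hl : 0 < l) (hSl : S ⊆ Icc l (2 * l)) :
    |∫ t in S, g (p * t)| ≤ 4 * l * (1 + (l * p) ^ 2)⁻¹ := by
  obtain ⟨c, d, hc, hcd, hd, hae⟩ := hS.exists_ae_eq_Ioc (by linarith) hSl
  rw [setIntegral_congr_set hae, ← intervalIntegral.integral_of_le hcd]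
  exact abs_integral_g_mul_le p hl hc hcd hd

lemma abs_setIntegral_g_mul_le {S : Set ℝ} (hS : S.OrdConnected) {l : ℝ} (p : ℝ) (hl : 0 < l) :
    |∫ t in S ∩ {t | l < |t| ∧ |t| ≤ 2 * l}, g (p * t)| ≤ 8 * l * (1 + (l * p) ^ 2)⁻¹ := by
  have hsplit : S ∩ {t | l < |t| ∧ |t| ≤ 2 * l} =
      S ∩ Ioc l (2 * l) ∪ S ∩ Ico (-(2 * l)) (-l) := by
    ext t
    simp only [mem_inter_iff, mem_ofPred_eq, mem_union, mem_Ioc, mem_Ico, lt_abs, abs_le]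
    constructor
    · rintro ⟨h, h1 | h1, h2, h3⟩
      · exact Or.inl ⟨h, h1, h3⟩
      · exact Or.inr ⟨h, h2, by linarith⟩
    · rintro (⟨h, h1, h2⟩ | ⟨h, h1, h2⟩)
      · exact ⟨h, Or.inl h1, by linarith, h2⟩
      · exact ⟨h, Or.inr (by linarith), h1, by linarith⟩
  have hg : Continuous fun x => g (p * x) := continuous_g.comp (by fun_prop)
  have hpos : (S ∩ Ioc l (2 * l)).OrdConnected := hS.inter ordConnected_Ioc
  have hneg : (S ∩ Ico (-(2 * l)) (-l)).OrdConnected := hS.inter ordConnected_Ico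
  have hint : ∀ {U : Set ℝ}, U ⊆ Icc (-(2 * l)) (2 * l) → IntegrableOn (fun t => g (p * t)) U :=
    fun hU => (hg.integrableOn_Icc).mono_set hU
  rw [hsplit, setIntegral_union _ hneg.measurableSet
    (hint fun t ht => ⟨by linarith [ht.2.1], ht.2.2⟩)
    (hint fun t ht => ⟨ht.2.1, by linarith [ht.2.2]⟩)]
  · have h1 := abs_setIntegral_g_mul_le_of_subset_Icc hpos p hl
      fun t ht => ⟨ht.2.1.le, ht.2.2⟩
    have h2 : |∫ t in S ∩ Ico (-(2 * l)) (-l), g (p * t)| ≤ 4 * l * (1 + (l * p) ^ 2)⁻¹ := by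
      have hpre : S ∩ Ico (-(2 * l)) (-l) =
          Neg.neg ⁻¹' (Neg.neg ⁻¹' (S ∩ Ico (-(2 * l)) (-l))) := by
        ext; simp
      have hflip : ∫ t in S ∩ Ico (-(2 * l)) (-l), g (p * t) =
          ∫ t in Neg.neg ⁻¹' (S ∩ Ico (-(2 * l)) (-l)), g (p * t) := by
        have h := (Measure.measurePreserving_neg (volume : Measure ℝ)).setIntegral_preimage_emb
          (MeasurableEquiv.neg ℝ).measurableEmbedding (fun t => g (p * t))
          (Neg.neg ⁻¹' (S ∩ Ico (-(2 * l)) (-l)))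
        rw [← h, ← hpre]
        simp [g_neg]
      rw [hflip]
      refine abs_setIntegral_g_mul_le_of_subset_Icc ?_ p hl fun t ht => ?_
      · exact hneg.preimage_anti fun _ _ h => neg_le_neg h
      · have := ht.2.1
        have := ht.2.2
        constructor <;> linarith
    exact (abs_add_le _ _).trans (by linarith)
  · refine Set.disjoint_left.2 fun t h1 h2 => ?_
    linarith [h1.2.1, h2.2.2]

lemma lintegral_pi_prod {n : ℕ} (μ : Measure ℝ) [SigmaFinite μ] {f : ℝ → ℝ≥0∞}
    (hf : Measurable f) :
    ∫⁻ x : Fin n → ℝ, ∏ i, f (x i) ∂(Measure.pi fun _ => μ) = (∫⁻ x, f x ∂μ) ^ n := by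
  induction n with
  | zero => simp
  | succ n ih =>
    have h := (measurePreserving_piFinSuccAbove (fun _ : Fin (n + 1) => μ) 0).symm
    rw [← h.lintegral_comp (by fun_prop)]
    simp only [Fin.prod_univ_succ]
    have := lintegral_prod_mul (μ := μ) (ν := Measure.pi fun _ : Fin n => μ) (f := f)
      (g := fun x => ∏ i, f (x i)) hf.aemeasurable
      (Finset.measurable_prod _ fun i _ => hf.comp (measurable_pi_apply i)).aemeasurable
    rw [ih, ← pow_succ'] at this
    simpa [MeasurableEquiv.piFinSuccAbove] using this

lemma setLIntegral_abs_rpow_le {R δ : ℝ} (hR : 0 < R) (hδ : 0 < δ) :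
    ∫⁻ s in Icc (-R) R, (ENNReal.ofReal |s|) ^ (δ - 1) ≤ ENNReal.ofReal (2 * (R ^ δ / δ)) := by
  have hpos : ∫⁻ s in Ioc 0 R, (ENNReal.ofReal |s|) ^ (δ - 1) = ENNReal.ofReal (R ^ δ / δ) := by
    have hval : ∫ s in Ioc 0 R, s ^ (δ - 1) = R ^ δ / δ := by
      rw [← intervalIntegral.integral_of_le hR.le, integral_rpow (Or.inl (by linarith))]
      simp [Real.zero_rpow hδ.ne']
    rw [← hval, ofReal_integral_eq_lintegral_ofReal
      ((intervalIntegrable_iff_integrableOn_Ioc_of_le hR.le).1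
        (intervalIntegral.intervalIntegrable_rpow' (by linarith)))
      ((ae_restrict_mem measurableSet_Ioc).mono fun s hs => Real.rpow_nonneg hs.1.le _)]
    refine setLIntegral_congr_fun measurableSet_Ioc fun s hs => ?_
    simp only [abs_of_pos hs.1, ENNReal.ofReal_rpow_of_pos hs.1]
  have hneg : ∫⁻ s in Ico (-R) 0, (ENNReal.ofReal |s|) ^ (δ - 1) = ENNReal.ofReal (R ^ δ / δ) := by
    rw [← hpos]
    have h := (Measure.measurePreserving_neg (volume : Measure ℝ)).setLIntegral_comp_preimage_emb
      (MeasurableEquiv.neg ℝ).measurableEmbedding (fun s => (ENNReal.ofReal |s|) ^ (δ - 1))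
      (Ioc 0 R)
    rw [← h]
    simp
  have hcover : Icc (-R) R =ᵐ[volume] (Ico (-R) 0 ∪ Ioc 0 R : Set ℝ) := by
    have : Icc (-R) R = insert 0 (Ico (-R) 0 ∪ Ioc 0 R) := by
      ext s
      simp only [mem_Icc, mem_insert_iff, mem_union, mem_Ico, mem_Ioc]
      constructor
      · rintro ⟨h1, h2⟩
        rcases lt_trichotomy s 0 with h | h | h
        · exact Or.inr (Or.inl ⟨h1, h⟩)
        · exact Or.inl h
        · exact Or.inr (Or.inr ⟨h, h2⟩)
      · rintro (rfl | h | h)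
        · constructor <;> linarith
        · constructor <;> linarith [h.1, h.2]
        · constructor <;> linarith [h.1, h.2]
    rw [this]
    exact insert_ae_eq_self _ _
  rw [setLIntegral_congr hcover]
  refine (lintegral_union_le _ _ _).trans ?_
  rw [hpos, hneg, ← ENNReal.ofReal_add (by positivity) (by positivity), two_mul]

lemma setLIntegral_inv_one_add_sq_le {l R δ : ℝ} (q : ℝ) (hl : 0 < l) (hR : 0 < R) (hδ : 0 ≤ δ)
    (hδ1 : δ ≤ 1) :
    ∫⁻ s in Icc (-R) R, ENNReal.ofReal (8 * l * (1 + (l * (s * q)) ^ 2)⁻¹) ≤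
      ENNReal.ofReal (32 * (l * R) ^ δ) * (ENNReal.ofReal |q|) ^ (δ - 1) := by
  set B := ∫⁻ s in Icc (-R) R, ENNReal.ofReal (8 * l * (1 + (l * (s * q)) ^ 2)⁻¹)
  have h1 : B ≤ ENNReal.ofReal (32 * (l * R)) := by
    calc B ≤ ∫⁻ s in Icc (-R) R, ENNReal.ofReal (8 * l) := by
          refine lintegral_mono fun s => ENNReal.ofReal_le_ofReal ?_
          refine mul_le_of_le_one_right (by positivity) (inv_le_one_of_one_le₀ ?_)
          nlinarith [sq_nonneg (l * (s * q))]
      _ = ENNReal.ofReal (8 * l) * ENNReal.ofReal (R - -R) := by simp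
      _ ≤ _ := by
          rw [← ENNReal.ofReal_mul (by positivity)]
          exact ENNReal.ofReal_le_ofReal (by nlinarith [mul_pos hl hR])
  have h2 : B ≤ ENNReal.ofReal 32 / ENNReal.ofReal |q| := by
    rcases eq_or_ne q 0 with rfl | hq
    · simp [ENNReal.div_zero]
    have hlq : l * q ≠ 0 := mul_ne_zero hl.ne' hq
    have hint : Integrable fun s : ℝ => 8 * l * (1 + (l * q * s) ^ 2)⁻¹ :=
      (integrable_inv_one_add_sq.comp_mul_left' hlq).const_mul _
    calc B ≤ ∫⁻ s, ENNReal.ofReal (8 * l * (1 + (l * (s * q)) ^ 2)⁻¹) := setLIntegral_le_lintegral _ _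
      _ = ∫⁻ s, ENNReal.ofReal (8 * l * (1 + (l * q * s) ^ 2)⁻¹) := by
          refine lintegral_congr fun s => ?_
          rw [mul_comm s q, mul_assoc l q s]
      _ = ENNReal.ofReal (∫ s, 8 * l * (1 + (l * q * s) ^ 2)⁻¹) :=
          (ofReal_integral_eq_lintegral_ofReal hint
            (Filter.Eventually.of_forall fun s => by positivity)).symm
      _ = ENNReal.ofReal (8 * π / |q|) := by
          rw [integral_const_mul, Measure.integral_comp_mul_left (fun x : ℝ => (1 + x ^ 2)⁻¹),
            integral_univ_inv_one_add_sq, abs_inv, abs_mul, abs_of_pos hl, smul_eq_mul]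
          congr 1
          have := abs_pos.2 hq
          field_simp
      _ ≤ ENNReal.ofReal (32 / |q|) := by
          refine ENNReal.ofReal_le_ofReal ?_
          gcongr
          linarith [Real.pi_le_four]
      _ = _ := ENNReal.ofReal_div_of_pos (abs_pos.2 hq)
  have h32 : ENNReal.ofReal 32 ≠ 0 := by simp
  calc B = B ^ δ * B ^ (1 - δ) := by
        rw [← ENNReal.rpow_add_of_nonneg _ _ hδ (by linarith)]
        simp
    _ ≤ (ENNReal.ofReal (32 * (l * R))) ^ δ *
          (ENNReal.ofReal 32 / ENNReal.ofReal |q|) ^ (1 - δ) := by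
        gcongr
    _ = (ENNReal.ofReal 32 ^ δ * ENNReal.ofReal 32 ^ (1 - δ)) * ENNReal.ofReal (l * R) ^ δ *
          (ENNReal.ofReal |q|) ^ (δ - 1) := by
        rw [ENNReal.ofReal_mul (by norm_num), ENNReal.mul_rpow_of_nonneg _ _ hδ,
          ENNReal.div_rpow_of_nonneg _ _ (by linarith), ENNReal.div_eq_inv_mul,
          ← ENNReal.rpow_neg, neg_sub]
        ring
    _ = _ := by
        rw [← ENNReal.rpow_add _ _ h32 ENNReal.ofReal_ne_top, add_sub_cancel, ENNReal.rpow_one,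
          ENNReal.ofReal_rpow_of_pos (by positivity), ← ENNReal.ofReal_mul (by norm_num)]

/-- The part of the sup-norm shell `l < ‖t‖ ≤ 2 * l` on which `j` is the first coordinate whose
absolute value exceeds `l`. -/
def shellPiece {n : ℕ} (l : ℝ) (j : Fin n) : Set (Fin n → ℝ) :=
  {t | (l < |t j| ∧ |t j| ≤ 2 * l) ∧ (∀ i, i < j → |t i| ≤ l) ∧ ∀ i, |t i| ≤ 2 * l}

lemma measurableSet_shellPiece {n : ℕ} (l : ℝ) (j : Fin n) : MeasurableSet (shellPiece l j) := by
  have h : ∀ i : Fin n, Measurable fun t : Fin n → ℝ => |t i| := fun i => by fun_prop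
  have hpiece : shellPiece l j = ({t | l < |t j|} ∩ {t | |t j| ≤ 2 * l}) ∩
      ((⋂ i, ⋂ _ : i < j, {t | |t i| ≤ l}) ∩ ⋂ i, {t | |t i| ≤ 2 * l}) := by
    ext
    simp [shellPiece]
  rw [hpiece]
  exact ((measurableSet_lt measurable_const (h j)).inter
    (measurableSet_le (h j) measurable_const)).inter
    ((MeasurableSet.iInter fun i => MeasurableSet.iInter fun _ =>
      measurableSet_le (h i) measurable_const).inter
    (MeasurableSet.iInter fun i => measurableSet_le (h i) measurable_const))

lemma iUnion_shellPiece {n : ℕ} {l : ℝ} (hl : 0 < l) :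
    ⋃ j : Fin n, shellPiece l j = {t | l < ‖t‖ ∧ ‖t‖ ≤ 2 * l} := by
  ext t
  simp only [shellPiece, mem_iUnion, mem_ofPred_eq, pi_norm_le_iff_of_nonneg (x := t)
    (by positivity : 0 ≤ 2 * l), Real.norm_eq_abs]
  constructor
  · rintro ⟨j, ⟨h1, -⟩, -, h2⟩
    exact ⟨h1.trans_le (norm_le_pi_norm t j), h2⟩
  · rintro ⟨h1, h2⟩
    have hex : ∃ i, l < |t i| := by
      by_contra! h
      exact h1.not_ge ((pi_norm_le_iff_of_nonneg hl.le).2 h)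
    obtain ⟨j, hj, hmin⟩ := WellFounded.has_min (wellFounded_lt (α := Fin n)) {i | l < |t i|} hex
    exact ⟨j, ⟨hj, h2 j⟩, fun i hi => not_lt.1 fun h => hmin i h hi, h2⟩

lemma pairwise_disjoint_shellPiece {n : ℕ} (l : ℝ) :
    Pairwise (Function.onFun Disjoint (shellPiece (n := n) l)) := by
  intro i j hij
  refine Set.disjoint_left.2 fun t hi hj => ?_
  rcases hij.lt_or_gt with h | h
  · exact (hj.2.1 i h).not_gt hi.1.1
  · exact (hi.2.1 j h).not_gt hj.1.1

lemma Convex.ordConnected_preimage_insertNth {n : ℕ} {D : Set (Fin (n + 1) → ℝ)}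
    (hD : Convex ℝ D) (j : Fin (n + 1)) (y : Fin n → ℝ) :
    {x : ℝ | j.insertNth x y ∈ D}.OrdConnected := by
  refine Convex.ordConnected fun x hx z hz a b ha hb hab => ?_
  have h := hD hx hz ha hb hab
  have heq : (j.insertNth (a • x + b • z) y : Fin (n + 1) → ℝ) =
      a • (j.insertNth x y : Fin (n + 1) → ℝ) + b • (j.insertNth z y : Fin (n + 1) → ℝ) := by
    funext i
    refine Fin.succAboveCases j ?_ (fun i => ?_) i
    · simp
    · simp [← add_mul, hab]
  rw [mem_ofPred_eq, heq]
  exact h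

lemma enorm_integral_insertNth_le {n : ℕ} {D : Set (Fin (n + 1) → ℝ)} (hD : Convex ℝ D) {l : ℝ}
    (hl : 0 < l) (j : Fin (n + 1)) (y : Fin n → ℝ) :
    ‖∫ x : ℝ, (D ∩ shellPiece l j).indicator (fun t => g (∏ i, t i)) (j.insertNth x y)‖ₑ ≤
      (univ.pi fun _ => Icc (-(2 * l)) (2 * l)).indicator
        (fun y => ENNReal.ofReal (8 * l * (1 + (l * ∏ i, y i) ^ 2)⁻¹)) y := by
  by_cases hy : (∀ i, j.succAbove i < j → |y i| ≤ l) ∧ ∀ i, |y i| ≤ 2 * l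
  · have hcube : y ∈ univ.pi fun _ => Icc (-(2 * l)) (2 * l) := fun i _ => abs_le.1 (hy.2 i)
    rw [indicator_of_mem hcube]
    set S := {x : ℝ | j.insertNth x y ∈ D}
    have hmem : ∀ x, j.insertNth x y ∈ D ∩ shellPiece l j ↔
        x ∈ S ∩ {t | l < |t| ∧ |t| ≤ 2 * l} := fun x => by
      have h1 := hy.1
      have h2 := hy.2
      simp only [shellPiece, mem_inter_iff, mem_ofPred_eq, Fin.forall_iff_succAbove j,
        Fin.insertNth_apply_same, Fin.insertNth_apply_succAbove, S]
      simp only [lt_irrefl, false_imp_iff, true_and]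
      tauto
    have hS : S.OrdConnected := hD.ordConnected_preimage_insertNth j y
    have habs : Measurable fun t : ℝ => |t| := by fun_prop
    have hband : MeasurableSet {t : ℝ | l < |t| ∧ |t| ≤ 2 * l} :=
      (measurableSet_lt measurable_const habs).inter (measurableSet_le habs measurable_const)
    have heq : ∫ x : ℝ, (D ∩ shellPiece l j).indicator (fun t => g (∏ i, t i)) (j.insertNth x y) =
        ∫ x in S ∩ {t | l < |t| ∧ |t| ≤ 2 * l}, g ((∏ i, y i) * x) := by
      rw [← integral_indicator (hS.measurableSet.inter hband)]
      refine integral_congr_ae (Filter.Eventually.of_forall fun x => ?_)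
      by_cases hx : x ∈ S ∩ {t | l < |t| ∧ |t| ≤ 2 * l}
      · simp only [indicator_of_mem hx, indicator_of_mem ((hmem x).2 hx),
          Fin.prod_univ_succAbove _ j, Fin.insertNth_apply_same, Fin.insertNth_apply_succAbove,
          mul_comm x]
      · simp only [indicator_of_notMem hx, indicator_of_notMem (mt (hmem x).1 hx)]
    rw [heq, Real.enorm_eq_ofReal_abs]
    exact ENNReal.ofReal_le_ofReal (abs_setIntegral_g_mul_le hS _ hl)
  · have hzero : ∀ x : ℝ,
        (D ∩ shellPiece l j).indicator (fun t => g (∏ i, t i)) (j.insertNth x y) = 0 := fun x => by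
      refine indicator_of_notMem (fun h => hy ⟨fun i hi => ?_, fun i => ?_⟩) _
      · simpa using h.2.2.1 (j.succAbove i) hi
      · simpa using h.2.2.2 (j.succAbove i)
    simp [hzero]

lemma setLIntegral_pi_inv_one_add_sq_le {m : ℕ} {l R δ : ℝ} (hl : 0 < l) (hR : 0 < R)
    (hδ : 0 < δ) (hδ1 : δ ≤ 1) :
    ∫⁻ y : Fin (m + 1) → ℝ in univ.pi fun _ => Icc (-R) R,
        ENNReal.ofReal (8 * l * (1 + (l * ∏ i, y i) ^ 2)⁻¹) ≤
      ENNReal.ofReal (32 * (l * R) ^ δ * (2 * (R ^ δ / δ)) ^ m) := by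
  rw [volume_pi, Measure.restrict_pi_pi]
  set μ : Measure ℝ := volume.restrict (Icc (-R) R)
  have h := (measurePreserving_piFinSuccAbove (fun _ : Fin (m + 1) => μ) 0).symm
  rw [← h.lintegral_comp (by fun_prop)]
  simp only [Fin.prod_univ_succ]
  rw [lintegral_prod_symm _ (by fun_prop)]
  calc _ ≤ ∫⁻ y : Fin m → ℝ, ENNReal.ofReal (32 * (l * R) ^ δ) *
        ∏ i, (ENNReal.ofReal |y i|) ^ (δ - 1) ∂(Measure.pi fun _ => μ) := by
        refine lintegral_mono fun y => ?_
        rw [ENNReal.prod_rpow_of_ne_top (fun _ _ => ENNReal.ofReal_ne_top),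
          ← ENNReal.ofReal_prod_of_nonneg (fun _ _ => abs_nonneg _), ← Finset.abs_prod]
        simpa [MeasurableEquiv.piFinSuccAbove] using
          setLIntegral_inv_one_add_sq_le (∏ i, y i) hl hR hδ.le hδ1
    _ = ENNReal.ofReal (32 * (l * R) ^ δ) *
          (∫⁻ s in Icc (-R) R, (ENNReal.ofReal |s|) ^ (δ - 1)) ^ m := by
        rw [lintegral_const_mul' _ _ ENNReal.ofReal_ne_top,
          lintegral_pi_prod μ (f := fun s => ENNReal.ofReal |s| ^ (δ - 1)) (by fun_prop)]
    _ ≤ ENNReal.ofReal (32 * (l * R) ^ δ) * ENNReal.ofReal (2 * (R ^ δ / δ)) ^ m := by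
        gcongr
        exact setLIntegral_abs_rpow_le hR hδ
    _ = _ := by
        rw [← ENNReal.ofReal_pow (by positivity), ← ENNReal.ofReal_mul (by positivity)]

lemma integrableOn_g_prod {n : ℕ} {D : Set (Fin n → ℝ)} (hD : IsCompact D) :
    IntegrableOn (fun t : Fin n → ℝ => g (∏ i, t i)) D :=
  (continuous_g.comp (by fun_prop)).continuousOn.integrableOn_compact hD

lemma abs_setIntegral_shellPiece_le {m : ℕ} {D : Set (Fin (m + 2) → ℝ)} (hDc : IsCompact D)
    (hD : Convex ℝ D) {l δ : ℝ} (hl : 0 < l) (hδ : 0 < δ) (hδ1 : δ ≤ 1) (j : Fin (m + 2)) :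
    |∫ t in D ∩ shellPiece l j, g (∏ i, t i)| ≤
      32 * (l * (2 * l)) ^ δ * (2 * ((2 * l) ^ δ / δ)) ^ m := by
  have hmeas : MeasurableSet (D ∩ shellPiece l j) :=
    hDc.measurableSet.inter (measurableSet_shellPiece l j)
  have hint : Integrable ((D ∩ shellPiece l j).indicator fun t => g (∏ i, t i)) :=
    ((integrableOn_g_prod hDc).mono_set inter_subset_left).integrable_indicator hmeas
  have hmp := (volume_preserving_piFinSuccAbove (fun _ : Fin (m + 2) => ℝ) j).symm
  have hint' := hmp.integrable_comp_of_integrable hint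
  have hfubini : ∫ t in D ∩ shellPiece l j, g (∏ i, t i) = ∫ y : Fin (m + 1) → ℝ, ∫ x : ℝ,
      (D ∩ shellPiece l j).indicator (fun t => g (∏ i, t i)) (j.insertNth x y) := by
    rw [← integral_indicator hmeas, ← hmp.integral_comp']
    exact integral_prod_symm _ hint'
  rw [hfubini, ← ENNReal.ofReal_le_ofReal_iff (by positivity),
    ← Real.enorm_eq_ofReal_abs]
  refine (enorm_integral_le_lintegral_enorm _).trans ?_
  refine (lintegral_mono fun y => enorm_integral_insertNth_le hD hl j y).trans ?_
  rw [lintegral_indicator (MeasurableSet.univ_pi fun _ => measurableSet_Icc)]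
  exact setLIntegral_pi_inv_one_add_sq_le hl (by positivity) hδ hδ1

/-- For every `k ≥ 2` there is `C > 0` such that for every compact convex set `D ⊂ ℝ^k` and
every integer `d ≥ 1`, the integral of `g (t₁ ⋯ t_k)` over
`D ∩ { t : 2^d < |t|_∞ ≤ 2^(d+1) }` is at most `C · d^(k-2)` in absolute value.
(The sup norm `|t|_∞` is the norm of the Pi type `Fin k → ℝ`.) -/
theorem dyadic_shell_integral_upper_bound (k : ℕ) (hk : 2 ≤ k) :
    ∃ C : ℝ, 0 < C ∧ ∀ D : Set (Fin k → ℝ), IsCompact D → Convex ℝ D →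
      ∀ d : ℕ, 1 ≤ d →
      |∫ t in D ∩ {t : Fin k → ℝ | (2:ℝ) ^ d < ‖t‖ ∧ ‖t‖ ≤ (2:ℝ) ^ (d + 1)},
          g (∏ i, t i)| ≤ C * (d : ℝ) ^ (k - 2) := by
  obtain ⟨m, rfl⟩ := Nat.exists_eq_add_of_le' hk
  refine ⟨(m + 2) * (256 * 8 ^ m), by positivity, fun D hDc hD d hd => ?_⟩
  have hd0 : (0 : ℝ) < d := by exact_mod_cast hd
  have hd1 : (1 : ℝ) ≤ d := by exact_mod_cast hd
  have hl : (0 : ℝ) < 2 ^ d := by positivity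
  have hunion : D ∩ {t : Fin (m + 2) → ℝ | (2:ℝ) ^ d < ‖t‖ ∧ ‖t‖ ≤ (2:ℝ) ^ (d + 1)} =
      ⋃ j, D ∩ shellPiece (2 ^ d) j := by
    rw [← inter_iUnion, iUnion_shellPiece hl, pow_succ' (2 : ℝ) d]
  rw [hunion, integral_iUnion_fintype
    (fun j => hDc.measurableSet.inter (measurableSet_shellPiece _ j))
    (fun i j hij => (pairwise_disjoint_shellPiece _ hij).mono inter_subset_right inter_subset_right)
    (fun j => (integrableOn_g_prod hDc).mono_set inter_subset_left)]
  have hδ1 : (d : ℝ)⁻¹ ≤ 1 := inv_le_one_of_one_le₀ hd1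
  have hpow : ((2 : ℝ) ^ d) ^ (d : ℝ)⁻¹ = 2 :=
    Real.pow_rpow_inv_natCast (by norm_num) (by omega)
  have hR : (2 * (2 : ℝ) ^ d) ^ (d : ℝ)⁻¹ ≤ 4 := by
    rw [Real.mul_rpow (by norm_num) hl.le, hpow]
    have : (2 : ℝ) ^ (d : ℝ)⁻¹ ≤ 2 ^ (1 : ℝ) := Real.rpow_le_rpow_of_exponent_le (by norm_num) hδ1
    rw [Real.rpow_one] at this
    linarith
  have hlR : ((2 : ℝ) ^ d * (2 * 2 ^ d)) ^ (d : ℝ)⁻¹ ≤ 8 := by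
    rw [Real.mul_rpow hl.le (by positivity), hpow]
    linarith
  have hpiece : ∀ j : Fin (m + 2), |∫ t in D ∩ shellPiece (2 ^ d) j, g (∏ i, t i)| ≤
      256 * 8 ^ m * (d : ℝ) ^ m := fun j => by
    refine (abs_setIntegral_shellPiece_le hDc hD hl (inv_pos.2 hd0) hδ1 j).trans ?_
    rw [mul_assoc 256, ← mul_pow]
    refine mul_le_mul (by linarith) ?_ (by positivity) (by norm_num)
    refine pow_le_pow_left₀ (by positivity) ?_ m
    rw [div_inv_eq_mul]
    nlinarith
  calc _ ≤ ∑ j : Fin (m + 2), |∫ t in D ∩ shellPiece (2 ^ d) j, g (∏ i, t i)| :=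
        Finset.abs_sum_le_sum_abs _ _
    _ ≤ ∑ _j : Fin (m + 2), 256 * 8 ^ m * (d : ℝ) ^ m := Finset.sum_le_sum fun j _ => hpiece j
    _ = _ := by
        simp
        ring
end

section
/- There exists a constant C > 0 such that for all real numbers a ≤ b, the absolute value of the integral ∫ₐᵇ g(x) dx is at most C. Equivalently, the sine integral x ↦ ∫₀ˣ (sin u)/u du is uniformly bounded on ℝ. -/
open MeasureTheory Real

theorem hasDerivAt_integral_sinc (x : ℝ) :
    HasDerivAt (fun y => ∫ u in (0 : ℝ)..y, sinc u) (sinc x) x :=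
  intervalIntegral.integral_hasDerivAt_right (continuous_sinc.intervalIntegrable _ _)
    continuous_sinc.stronglyMeasurable.stronglyMeasurableAtFilter continuous_sinc.continuousAt

theorem abs_integral_sinc_le_abs (x : ℝ) : |∫ u in (0 : ℝ)..x, sinc u| ≤ |x| := by
  simpa using intervalIntegral.norm_integral_le_of_norm_le_const (f := sinc) (a := 0) (b := x)
    (C := 1) fun u _ => abs_sinc_le_one u

theorem integral_sinc_neg (x : ℝ) :
    ∫ u in (0 : ℝ)..(-x), sinc u = -∫ u in (0 : ℝ)..x, sinc u := by
  rw [intervalIntegral.integral_symm]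
  simpa using (intervalIntegral.integral_comp_neg (a := 0) (b := x) sinc).symm

/-- The correction `(cos x + c) / x` turns the derivative of the sine integral into
`-(cos x + c) / x ^ 2`, which has constant sign when `|c| = 1`. -/
theorem hasDerivAt_integral_sinc_add (c : ℝ) {x : ℝ} (hx : x ≠ 0) :
    HasDerivAt (fun y => (∫ u in (0 : ℝ)..y, sinc u) + (cos y + c) / y)
      (-(cos x + c) / x ^ 2) x := by
  have h := (hasDerivAt_integral_sinc x).add
    (((hasDerivAt_cos x).add_const c).div (hasDerivAt_id x) hx)
  refine h.congr_deriv ?_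
  rw [sinc_of_ne_zero hx]
  simp only [id]
  field_simp
  ring

theorem abs_integral_sinc_le_three_of_one_le {x : ℝ} (hx : 1 ≤ x) :
    |∫ u in (0 : ℝ)..x, sinc u| ≤ 3 := by
  have hd (c : ℝ) {y : ℝ} (hy : 1 ≤ y) :=
    hasDerivAt_integral_sinc_add c (zero_lt_one.trans_le hy).ne'
  have hcont (c : ℝ) : ContinuousOn
      (fun y => (∫ u in (0 : ℝ)..y, sinc u) + (cos y + c) / y) (Set.Ici 1) :=
    fun y hy => (hd c hy).continuousAt.continuousWithinAt
  have hanti := antitoneOn_of_hasDerivWithinAt_nonpos (convex_Ici 1) (hcont 1)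
    (fun y hy => (hd 1 (interior_subset hy)).hasDerivWithinAt)
    (fun y _ => div_nonpos_of_nonpos_of_nonneg (by linarith [neg_one_le_cos y]) (sq_nonneg y))
    Set.self_mem_Ici hx hx
  have hmono := monotoneOn_of_hasDerivWithinAt_nonneg (convex_Ici 1) (hcont (-1))
    (fun y hy => (hd (-1) (interior_subset hy)).hasDerivWithinAt)
    (fun y _ => div_nonneg (by linarith [cos_le_one y]) (sq_nonneg y))
    Set.self_mem_Ici hx hx
  have h_one := abs_le.mp (abs_integral_sinc_le_abs 1)
  have hx₀ : 0 ≤ x := zero_le_one.trans hx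
  have h_lower : 0 ≤ (cos x + 1) / x := div_nonneg (by linarith [neg_one_le_cos x]) hx₀
  have h_upper : (cos x + -1) / x ≤ 0 :=
    div_nonpos_of_nonpos_of_nonneg (by linarith [cos_le_one x]) hx₀
  simp only [div_one, abs_one] at hanti hmono h_one
  rw [abs_le]
  constructor <;> linarith [cos_le_one 1, neg_one_le_cos 1]

theorem abs_integral_sinc_le_three (x : ℝ) : |∫ u in (0 : ℝ)..x, sinc u| ≤ 3 := by
  rcases le_total |x| 1 with h | h
  · exact (abs_integral_sinc_le_abs x).trans (by linarith)
  · rcases le_abs.mp h with h | h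
    · exact abs_integral_sinc_le_three_of_one_le h
    · simpa [integral_sinc_neg] using abs_integral_sinc_le_three_of_one_le h

/-- The sine integral is uniformly bounded: there is `C > 0` such that
`|∫ₐᵇ g(x) dx| ≤ C` for all `a ≤ b`. -/
theorem sine_integral_uniformly_bounded :
    ∃ C : ℝ, 0 < C ∧ ∀ a b : ℝ, a ≤ b → |∫ x in a..b, g x| ≤ C := by
  refine ⟨6, by norm_num, fun a b _ => ?_⟩
  have hg : g = sinc := rfl
  rw [hg, ← intervalIntegral.integral_interval_sub_left
    (continuous_sinc.intervalIntegrable 0 b) (continuous_sinc.intervalIntegrable 0 a)]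
  linarith [abs_sub (∫ u in (0 : ℝ)..b, sinc u) (∫ u in (0 : ℝ)..a, sinc u),
    abs_integral_sinc_le_three a, abs_integral_sinc_le_three b]
end

section
/- Let F = g (restricted to [0,∞)) and let k ≥ 1 be an integer. Suppose there exist constants c > 0 and T₀ ≥ 1 such that ∫₀ᵗ H^{k-1}F(u) du ≥ c·(log t)^{k-1} for every t ≥ T₀. Then for every t ≥ T₀ one has ∫₀ᵗ H^{k}F(u) du ≥ (c/k)·((log t)^k − (log T₀)^k) − T₀. -/
open MeasureTheory Real

/-- The property of being measurable and bounded by `1`, preserved by `H`. -/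
def IsUnitBounded (f : ℝ → ℝ) : Prop := Measurable f ∧ ∀ x, |f x| ≤ 1

lemma IsUnitBounded.intervalIntegrable {f : ℝ → ℝ} (hf : IsUnitBounded f) (a b : ℝ) :
    IntervalIntegrable f volume a b := by
  refine (intervalIntegrable_const (c := (1 : ℝ))).mono_fun hf.1.aestronglyMeasurable ?_
  filter_upwards with x
  simpa using hf.2 x

lemma isUnitBounded_g : IsUnitBounded g := by
  refine ⟨Measurable.ite (measurableSet_singleton 0) measurable_const
    (Real.measurable_sin.div measurable_id), fun x => ?_⟩
  unfold g
  split_ifs with hx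
  · simp
  · rw [abs_div]
    exact div_le_one_of_le₀ Real.abs_sin_le_abs (abs_nonneg x)

lemma IsUnitBounded.abs_integral_le {f : ℝ → ℝ} (hf : IsUnitBounded f) (x : ℝ) :
    |∫ u in (0:ℝ)..x, f u| ≤ |x| := by
  simpa using intervalIntegral.norm_integral_le_of_norm_le_const (a := 0) (b := x) (C := 1)
    (f := f) fun u _ => hf.2 u

lemma IsUnitBounded.H {f : ℝ → ℝ} (hf : IsUnitBounded f) : IsUnitBounded (H f) := by
  refine ⟨Measurable.ite (measurableSet_singleton 0) measurable_const
    ((measurable_const.div measurable_id).mul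
      (intervalIntegral.continuous_primitive hf.intervalIntegrable 0).measurable), fun x => ?_⟩
  unfold _root_.H
  split_ifs with hx
  · exact hf.2 0
  · rw [one_div_mul_eq_div, abs_div]
    exact div_le_one_of_le₀ (hf.abs_integral_le x) (abs_nonneg x)

lemma isUnitBounded_iterate (n : ℕ) : IsUnitBounded (H^[n] g) := by
  induction n with
  | zero => exact isUnitBounded_g
  | succ n ih =>
    rw [Function.iterate_succ_apply']
    exact ih.H

lemma hasDerivAt_log_pow_succ (c : ℝ) (n : ℕ) {x : ℝ} (hx : x ≠ 0) :
    HasDerivAt (fun y => c / (n + 1 : ℕ) * Real.log y ^ (n + 1))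
      (1 / x * (c * Real.log x ^ n)) x := by
  have hn : ((n + 1 : ℕ) : ℝ) ≠ 0 := by positivity
  refine (((Real.hasDerivAt_log hx).pow (n + 1)).const_mul (c / (n + 1 : ℕ))).congr_deriv ?_
  rw [Nat.add_sub_cancel]
  field_simp

/-- Induction step: if `∫₀ᵗ H^(k-1) F ≥ c (log t)^(k-1)` for `t ≥ T₀ ≥ 1`, then
`∫₀ᵗ H^k F ≥ (c/k)((log t)^k − (log T₀)^k) − T₀` for `t ≥ T₀`, where `F = g`. -/
theorem iterated_average_induction_step (k : ℕ) (hk : 1 ≤ k) (c T₀ : ℝ)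
    (hc : 0 < c) (hT₀ : 1 ≤ T₀)
    (hyp : ∀ t : ℝ, T₀ ≤ t →
      c * (Real.log t) ^ (k - 1) ≤ ∫ u in (0:ℝ)..t, (H^[k - 1] g) u) :
    ∀ t : ℝ, T₀ ≤ t →
      c / k * ((Real.log t) ^ k - (Real.log T₀) ^ k) - T₀ ≤
        ∫ u in (0:ℝ)..t, (H^[k] g) u := by
  obtain ⟨n, rfl⟩ := Nat.exists_eq_add_of_le' hk
  rw [Nat.add_sub_cancel] at hyp
  intro t ht
  rw [Function.iterate_succ_apply']
  set f := H^[n] g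
  have hf : IsUnitBounded f := isUnitBounded_iterate n
  have hpos : ∀ x ∈ Set.Icc T₀ t, 0 < x := fun x hx => by linarith [hx.1]
  have hint : IntervalIntegrable (fun x => 1 / x * (c * Real.log x ^ n)) volume T₀ t := by
    apply ContinuousOn.intervalIntegrable_of_Icc ht
    have hne : ∀ x ∈ Set.Icc T₀ t, x ≠ 0 := fun x hx => (hpos x hx).ne'
    exact (continuousOn_const.div continuousOn_id hne).mul
      (continuousOn_const.mul ((continuousOn_id.log hne).pow n))
  have hftc : ∫ x in T₀..t, 1 / x * (c * Real.log x ^ n) =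
      c / (n + 1 : ℕ) * (Real.log t ^ (n + 1) - Real.log T₀ ^ (n + 1)) := by
    rw [mul_sub]
    refine intervalIntegral.integral_eq_sub_of_hasDerivAt
      (f := fun y => c / (n + 1 : ℕ) * Real.log y ^ (n + 1)) (fun x hx => ?_) hint
    rw [Set.uIcc_of_le ht] at hx
    exact hasDerivAt_log_pow_succ c n (hpos x hx).ne'
  have htail : ∫ x in T₀..t, 1 / x * (c * Real.log x ^ n) ≤ ∫ x in T₀..t, H f x := by
    refine intervalIntegral.integral_mono_on ht hint (hf.H.intervalIntegrable _ _) fun x hx => ?_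
    have hx0 := hpos x hx
    rw [H, if_neg hx0.ne']
    exact mul_le_mul_of_nonneg_left (hyp x hx.1) (by positivity)
  have hhead := (abs_le.mp (hf.H.abs_integral_le T₀)).1
  rw [abs_of_nonneg (by linarith)] at hhead
  rw [← intervalIntegral.integral_add_adjacent_intervals
    (hf.H.intervalIntegrable 0 T₀) (hf.H.intervalIntegrable T₀ t)]
  linarith
end
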